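/- (Weak Harnack inequality) There exist positive constants ε₃ and C depending only on λ, Λ, K, C₀ and d, such that: for any 0 < r ≤ 1, any f ∈ L^d(Q_{9√d}) ∩ C(Q_{9√d}), and any nonnegative bounded lower semicontinuous function u that is a viscosity supersolution of −P⁻(D²u) − P⁻_{K,r}(u) + C₀ r |Du| ≥ f in the cube Q_{9√d}, one has ‖u‖_{L^{ε₃}(Q₁)} ≤ C (inf_{Q₁} u + ‖f‖_{L^d(Q_{9√d})}). -/

import Mathlib

open MeasureTheory Metric Set
open scoped RealInnerProductSpace ENNReal

noncomputable section

/-- `d`-dimensional Euclidean space. -/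
abbrev Ed (d : ℕ) : Type := EuclideanSpace ℝ (Fin d)

/-- A real-valued function on `ℝ^d` is bounded. -/
def IsBddFun {d : ℕ} (φ : Ed d → ℝ) : Prop := ∃ M, ∀ x, |φ x| ≤ M

/-- The open cube of half side length `δ` centered at `x`. -/
def cubeAt {d : ℕ} (x : Ed d) (δ : ℝ) : Set (Ed d) := {y | ∀ i, |y i - x i| < δ}

/-- The open cube `Q_δ = (-δ, δ)^d`. -/
def cube (d : ℕ) (δ : ℝ) : Set (Ed d) := cubeAt 0 δ

/-- Hessian matrix of `φ` at `x` (matrix of second derivatives). -/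
def hess {d : ℕ} (φ : Ed d → ℝ) (x : Ed d) : Matrix (Fin d) (Fin d) ℝ :=
  Matrix.of fun i j =>
    iteratedFDeriv ℝ 2 φ x ![EuclideanSpace.single i (1 : ℝ), EuclideanSpace.single j (1 : ℝ)]

/-- Symmetric matrices `A` with `λ I ≤ A ≤ Λ I`. -/
def ellipticSet (lam Lam : ℝ) (d : ℕ) : Set (Matrix (Fin d) (Fin d) ℝ) :=
  {A | A.IsSymm ∧ (A - lam • (1 : Matrix (Fin d) (Fin d) ℝ)).PosSemidef ∧
      (Lam • (1 : Matrix (Fin d) (Fin d) ℝ) - A).PosSemidef}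

/-- The Pucci maximal operator `P⁺`. -/
def pucciPlus {d : ℕ} (lam Lam : ℝ) (X : Matrix (Fin d) (Fin d) ℝ) : ℝ :=
  sSup ((fun A => (A * X).trace) '' ellipticSet lam Lam d)

/-- The Pucci minimal operator `P⁻`. -/
def pucciMinus {d : ℕ} (lam Lam : ℝ) (X : Matrix (Fin d) (Fin d) ℝ) : ℝ :=
  sInf ((fun A => (A * X).trace) '' ellipticSet lam Lam d)

/-- The Lévy kernel condition: `K ≥ 0` measurable with `∫ min(|z|²,1) K(z) dz < ∞`. -/
def KernCond {d : ℕ} (K : Ed d → ℝ) : Prop :=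
  Measurable K ∧ (∀ z, 0 ≤ K z) ∧ Integrable (fun z : Ed d => min (‖z‖ ^ 2) 1 * K z)

/-- The rescaled kernel `K_r(z) = r^{d+2} K(rz)`. -/
def Kresc {d : ℕ} (K : Ed d → ℝ) (r : ℝ) (z : Ed d) : ℝ := r ^ (d + 2) * K (r • z)

/-- The second-order increment `u(x+z) − u(x) − 1_{B_{1/r}}(z) Du(x)·z`. -/
def deltaOp {d : ℕ} (φ : Ed d → ℝ) (r : ℝ) (x z : Ed d) : ℝ :=
  φ (x + z) - φ x - (Metric.ball (0 : Ed d) (1 / r)).indicator (fun w => ⟪gradient φ x, w⟫) z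

/-- The maximal nonlocal Pucci operator `P⁺_{K,r}`. -/
def nlPlus {d : ℕ} (K : Ed d → ℝ) (r : ℝ) (φ : Ed d → ℝ) (x : Ed d) : ℝ :=
  ∫ z, max (deltaOp φ r x z) 0 * Kresc K r z

/-- The minimal nonlocal Pucci operator `P⁻_{K,r}`. -/
def nlMinus {d : ℕ} (K : Ed d → ℝ) (r : ℝ) (φ : Ed d → ℝ) (x : Ed d) : ℝ :=
  -∫ z, max (-deltaOp φ r x z) 0 * Kresc K r z

/-- Viscosity supersolution of `−P⁻(D²u) − P⁻_{K,r}(u) + C₀ r |Du| ≥ f` in `O`. -/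
def SupersolExtremal {d : ℕ} (lam Lam C0 r : ℝ) (K f : Ed d → ℝ) (O : Set (Ed d))
    (u : Ed d → ℝ) : Prop :=
  ∀ φ : Ed d → ℝ, ContDiff ℝ 2 φ → IsBddFun φ → ∀ x ∈ O, (∀ y, φ y ≤ u y) → u x = φ x →
    f x ≤ -pucciMinus lam Lam (hess φ x) - nlMinus K r φ x + C0 * r * ‖gradient φ x‖

/-- Viscosity subsolution of `P⁺(D²u) + P⁺_K(u) + C₀|Du| ≥ g` in `O`. -/
def SubsolPlus {d : ℕ} (lam Lam C0 : ℝ) (K g : Ed d → ℝ) (O : Set (Ed d)) (u : Ed d → ℝ) : Prop :=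
  ∀ φ : Ed d → ℝ, ContDiff ℝ 2 φ → IsBddFun φ → ∀ x ∈ O, (∀ y, u y ≤ φ y) → u x = φ x →
    g x ≤ pucciPlus lam Lam (hess φ x) + nlPlus K 1 φ x + C0 * ‖gradient φ x‖

/-- Viscosity supersolution of `P⁻(D²u) + P⁻_K(u) − C₀|Du| ≤ g` in `O`. -/
def SupersolMinus {d : ℕ} (lam Lam C0 : ℝ) (K g : Ed d → ℝ) (O : Set (Ed d)) (u : Ed d → ℝ) : Prop :=
  ∀ φ : Ed d → ℝ, ContDiff ℝ 2 φ → IsBddFun φ → ∀ x ∈ O, (∀ y, φ y ≤ u y) → u x = φ x →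
    pucciMinus lam Lam (hess φ x) + nlMinus K 1 φ x - C0 * ‖gradient φ x‖ ≤ g x

/-- Negative part `f⁻ = −min{f,0}`. -/
def nPart {d : ℕ} (f : Ed d → ℝ) : Ed d → ℝ := fun x => max (-f x) 0

/-- Positive part `f⁺ = max{f,0}`. -/
def pPart {d : ℕ} (f : Ed d → ℝ) : Ed d → ℝ := fun x => max (f x) 0

/-- The `L^p` norm of `f` on a set `S`. -/
def LnormOn {d : ℕ} (p : ℝ) (S : Set (Ed d)) (f : Ed d → ℝ) : ℝ :=
  (∫ x in S, |f x| ^ p) ^ (1 / p)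

/-- The nonlocal contact set `Γ^{n,−}_O(v)`. -/
def nContact {d : ℕ} (O : Set (Ed d)) (v : Ed d → ℝ) : Set (Ed d) :=
  {x | x ∈ O ∧ v x < sInf (v '' Oᶜ) ∧
      ∃ p : Ed d, ∀ y, Metric.infDist y O < Metric.diam O → v x + ⟪p, y - x⟫ ≤ v y}

/-- The set `G^u_M` of points where `u` is touched from below by a paraboloid of opening `M`. -/
def GSet {d : ℕ} (u : Ed d → ℝ) (M : ℝ) : Set (Ed d) :=
  {x | ∃ ρ > 0, ∃ A C : ℝ, ∃ B : Ed d, |A| + ‖B‖ + |C| ≤ M ∧ u x = A ∧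
      ∀ y ∈ Metric.ball x ρ, A + ⟪B, y - x⟫ - C / 2 * ‖y - x‖ ^ 2 ≤ u y}

/-- The bad set `B^u_M`. -/
def BSet {d : ℕ} (u : Ed d → ℝ) (M : ℝ) : Set (Ed d) := (GSet u M)ᶜ

/-- Upper semicontinuous envelope `u*`. -/
def usEnv {d : ℕ} (u : Ed d → ℝ) (x : Ed d) : ℝ :=
  ⨅ ρ : {ρ : ℝ // 0 < ρ}, ⨆ y : {y : Ed d // ‖y - x‖ ≤ ρ.1}, u y.1

/-- Lower semicontinuous envelope `u_*`. -/
def lsEnv {d : ℕ} (u : Ed d → ℝ) (x : Ed d) : ℝ :=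
  ⨆ ρ : {ρ : ℝ // 0 < ρ}, ⨅ y : {y : Ed d // ‖y - x‖ ≤ ρ.1}, u y.1

/-- A modulus of continuity. -/
def IsModulus (m : ℝ → ℝ) : Prop :=
  (∀ t, 0 ≤ m t) ∧ Monotone m ∧ m 0 = 0 ∧ ContinuousAt m 0

/-- The uniform exterior ball condition. -/
def ExtBallCond {d : ℕ} (Ω : Set (Ed d)) : Prop :=
  ∃ ρ > 0, ∀ ξ ∈ frontier Ω, ∃ y ∈ Ωᶜ, Metric.ball y ρ ⊆ Ωᶜ ∧ ξ ∈ Metric.sphere y ρ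

section HJBI

variable {d : ℕ} {𝒜 ℬ : Type}

/-- The linear nonlocal operator `I_{ab}[x, φ]`. -/
def Iop (N : 𝒜 → ℬ → Ed d → Ed d → ℝ) (a : 𝒜) (b : ℬ) (φ : Ed d → ℝ) (x : Ed d) : ℝ :=
  ∫ z, (φ (x + z) - φ x -
      (Metric.ball (0 : Ed d) 1).indicator (fun w => ⟪gradient φ x, w⟫) z) * N a b x z

/-- The HJBI operator evaluated at `φ`, with the zeroth order slot evaluated at `s`. -/
def HJBIat (aM : 𝒜 → ℬ → Ed d → Matrix (Fin d) (Fin d) ℝ) (bV : 𝒜 → ℬ → Ed d → Ed d)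
    (cF fF : 𝒜 → ℬ → Ed d → ℝ) (N : 𝒜 → ℬ → Ed d → Ed d → ℝ)
    (φ : Ed d → ℝ) (s : ℝ) (x : Ed d) : ℝ :=
  ⨆ a, ⨅ b, (-(aM a b x * hess φ x).trace - Iop N a b φ x +
    ⟪bV a b x, gradient φ x⟫ + cF a b x * s + fF a b x)

/-- The HJBI operator `ℐφ(x)`. -/
def HJBIop (aM : 𝒜 → ℬ → Ed d → Matrix (Fin d) (Fin d) ℝ) (bV : 𝒜 → ℬ → Ed d → Ed d)
    (cF fF : 𝒜 → ℬ → Ed d → ℝ) (N : 𝒜 → ℬ → Ed d → Ed d → ℝ)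
    (φ : Ed d → ℝ) (x : Ed d) : ℝ :=
  HJBIat aM bV cF fF N φ (φ x) x

/-- Viscosity subsolution of `ℐu = 0` in `Ω` (test function formulation). -/
def SubsolHJBI (aM : 𝒜 → ℬ → Ed d → Matrix (Fin d) (Fin d) ℝ) (bV : 𝒜 → ℬ → Ed d → Ed d)
    (cF fF : 𝒜 → ℬ → Ed d → ℝ) (N : 𝒜 → ℬ → Ed d → Ed d → ℝ) (Ω : Set (Ed d))
    (u : Ed d → ℝ) : Prop :=
  ∀ φ : Ed d → ℝ, ContDiff ℝ 2 φ → IsBddFun φ → ∀ x ∈ Ω, (∀ y, u y ≤ φ y) → u x = φ x →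
    HJBIop aM bV cF fF N φ x ≤ 0

/-- Viscosity supersolution of `ℐu = 0` in `Ω` (test function formulation). -/
def SupersolHJBI (aM : 𝒜 → ℬ → Ed d → Matrix (Fin d) (Fin d) ℝ) (bV : 𝒜 → ℬ → Ed d → Ed d)
    (cF fF : 𝒜 → ℬ → Ed d → ℝ) (N : 𝒜 → ℬ → Ed d → Ed d → ℝ) (Ω : Set (Ed d))
    (u : Ed d → ℝ) : Prop :=
  ∀ φ : Ed d → ℝ, ContDiff ℝ 2 φ → IsBddFun φ → ∀ x ∈ Ω, (∀ y, φ y ≤ u y) → u x = φ x →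
    0 ≤ HJBIop aM bV cF fF N φ x

/-- Uniform ellipticity of the HJBI operator `ℐ`. -/
def UnifElliptic (lam Lam C0 : ℝ) (K : Ed d → ℝ) (Ω : Set (Ed d))
    (aM : 𝒜 → ℬ → Ed d → Matrix (Fin d) (Fin d) ℝ) (bV : 𝒜 → ℬ → Ed d → Ed d)
    (cF fF : 𝒜 → ℬ → Ed d → ℝ) (N : 𝒜 → ℬ → Ed d → Ed d → ℝ) : Prop :=
  ∃ m : ℝ → ℝ, IsModulus m ∧
    ∀ r s : ℝ, ∀ x ∈ Ω, ∀ φ ψ : Ed d → ℝ,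
      ContDiff ℝ 2 φ → IsBddFun φ → ContDiff ℝ 2 ψ → IsBddFun ψ →
      (pucciMinus lam Lam (hess (fun y => φ y - ψ y) x) + nlMinus K 1 (fun y => φ y - ψ y) x -
          C0 * ‖gradient (fun y => ψ y - φ y) x‖ - m |r - s| ≤
        HJBIat aM bV cF fF N ψ r x - HJBIat aM bV cF fF N φ s x) ∧
      (HJBIat aM bV cF fF N ψ r x - HJBIat aM bV cF fF N φ s x ≤
        pucciPlus lam Lam (hess (fun y => φ y - ψ y) x) + nlPlus K 1 (fun y => φ y - ψ y) x +
          C0 * ‖gradient (fun y => ψ y - φ y) x‖ + m |r - s|)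

/-- Boundedness of the coefficient families, uniformly in `a, b`. -/
def FamiliesBdd (Ω : Set (Ed d)) (aM : 𝒜 → ℬ → Ed d → Matrix (Fin d) (Fin d) ℝ)
    (bV : 𝒜 → ℬ → Ed d → Ed d) (cF fF : 𝒜 → ℬ → Ed d → ℝ) : Prop :=
  ∃ Cb : ℝ, ∀ a b, ∀ x ∈ Ω, (∀ i j, |aM a b x i j| ≤ Cb) ∧ ‖bV a b x‖ ≤ Cb ∧
      |cF a b x| ≤ Cb ∧ |fF a b x| ≤ Cb

/-- Uniform continuity of the coefficient families with a common modulus, uniformly in `a, b, z`. -/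
def FamiliesUC (Ω : Set (Ed d)) (aM : 𝒜 → ℬ → Ed d → Matrix (Fin d) (Fin d) ℝ)
    (bV : 𝒜 → ℬ → Ed d → Ed d) (cF fF : 𝒜 → ℬ → Ed d → ℝ)
    (N : 𝒜 → ℬ → Ed d → Ed d → ℝ) : Prop :=
  ∃ m₀ : ℝ → ℝ, IsModulus m₀ ∧ ∀ a b, ∀ x ∈ Ω, ∀ y ∈ Ω,
      (∀ i j, |aM a b x i j - aM a b y i j| ≤ m₀ ‖x - y‖) ∧
      ‖bV a b x - bV a b y‖ ≤ m₀ ‖x - y‖ ∧ |cF a b x - cF a b y| ≤ m₀ ‖x - y‖ ∧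
      |fF a b x - fF a b y| ≤ m₀ ‖x - y‖ ∧ ∀ z, |N a b x z - N a b y z| ≤ m₀ ‖x - y‖

end HJBI

/-- The total mass of the Lévy kernel. -/
def CKer {d : ℕ} (K : Ed d → ℝ) : ℝ := ∫ z : Ed d, min (‖z‖ ^ 2) 1 * K z

theorem CKer_nonneg {d : ℕ} {K : Ed d → ℝ} (hK : KernCond K) : 0 ≤ CKer K :=
  integral_nonneg fun z => mul_nonneg (le_min (by positivity) zero_le_one) (hK.2.1 z)

theorem kresc_eq {d : ℕ} (K : Ed d → ℝ) {r : ℝ} (hr : 0 < r) (z : Ed d) :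
    min (‖z‖ ^ 2) (1 / r ^ 2) * Kresc K r z
      = r ^ d * (min (‖r • z‖ ^ 2) 1 * K (r • z)) := by
  have h : min (‖r • z‖ ^ 2) 1 = r ^ 2 * min (‖z‖ ^ 2) (1 / r ^ 2) := by
    rw [mul_min_of_nonneg _ _ (by positivity), norm_smul, Real.norm_of_nonneg hr.le, mul_pow,
      mul_one_div_cancel (by positivity)]
  rw [h, Kresc]; ring

theorem kresc_integrable {d : ℕ} {K : Ed d → ℝ} (hK : KernCond K) {r : ℝ} (hr : 0 < r) :
    Integrable (fun z => min (‖z‖ ^ 2) (1 / r ^ 2) * Kresc K r z) := by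
  simp_rw [kresc_eq K hr]
  exact (hK.2.2.comp_smul hr.ne').const_mul _

theorem kresc_integral {d : ℕ} {K : Ed d → ℝ} {r : ℝ} (hr : 0 < r) :
    ∫ z, min (‖z‖ ^ 2) (1 / r ^ 2) * Kresc K r z = CKer K := by
  simp_rw [kresc_eq K hr]
  rw [integral_const_mul, Measure.integral_comp_smul volume (fun z => min (‖z‖ ^ 2) 1 * K z) r]
  rw [finrank_euclideanSpace_fin, abs_of_pos (by positivity), smul_eq_mul, ← mul_assoc,
    mul_inv_cancel₀ (by positivity), one_mul, CKer]

theorem nl_bound {d : ℕ} {K : Ed d → ℝ} (hK : KernCond K) {r : ℝ} (hr : 0 < r)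
    {φ : Ed d → ℝ} {x : Ed d} {c : ℝ} (hc : 0 ≤ c)
    (h : ∀ z, -deltaOp φ r x z ≤ c * min (‖z‖ ^ 2) (1 / r ^ 2)) :
    -nlMinus K r φ x ≤ c * CKer K := by
  rw [nlMinus, neg_neg, ← kresc_integral (K := K) hr, ← integral_const_mul]
  have hKr : ∀ z, 0 ≤ Kresc K r z := fun z => mul_nonneg (by positivity) (hK.2.1 _)
  refine integral_mono_of_nonneg (Filter.Eventually.of_forall fun z => ?_)
    ((kresc_integrable hK hr).const_mul c) (Filter.Eventually.of_forall fun z => ?_)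
  · exact mul_nonneg (le_max_right _ _) (hKr z)
  · simp only []
    rw [← mul_assoc]
    exact mul_le_mul_of_nonneg_right (max_le (h z) (by positivity)) (hKr z)

open scoped MatrixOrder in
theorem trace_psd_nonneg {d : ℕ} {A S : Matrix (Fin d) (Fin d) ℝ} (hA : A.PosSemidef)
    (hS : ∀ x : Fin d → ℝ, 0 ≤ ∑ i, ∑ j, x i * S i j * x j) : 0 ≤ (A * S).trace := by
  obtain ⟨B, hB⟩ := CStarAlgebra.nonneg_iff_eq_star_mul_self.mp hA.nonneg
  rw [hB, Matrix.mul_assoc, Matrix.trace_mul_comm]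
  refine Finset.sum_nonneg fun i _ => ?_
  have := hS (fun j => B i j)
  refine this.trans (le_of_eq ?_)
  simp only [Matrix.diag_apply, Matrix.mul_apply, Matrix.star_apply, star_trivial, Finset.sum_mul]
  rw [Finset.sum_comm]

theorem pucciMinus_ge {d : ℕ} {lam Lam : ℝ} (hLam : lam ≤ Lam) {X : Matrix (Fin d) (Fin d) ℝ} {c : ℝ}
    (h : ∀ A ∈ ellipticSet lam Lam d, c ≤ (A * X).trace) : c ≤ pucciMinus lam Lam X := by
  apply le_csInf
  · refine ⟨_, lam • 1, ⟨by simp [Matrix.IsSymm], by simpa using Matrix.PosSemidef.zero, ?_⟩, rfl⟩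
    rw [← sub_smul]
    exact Matrix.PosSemidef.one.smul (by linarith)
  · rintro _ ⟨A, hA, rfl⟩
    exact h A hA

/-- The local model of the test function. -/
def model {d : ℕ} (c : ℝ) (p y : Ed d) (S : Ed d →L[ℝ] Ed d) (M α : ℝ) (x : Ed d) : ℝ :=
  c + ⟪p, x - y⟫ + ⟪S (x - y), x - y⟫ + M * Real.exp (-α * ‖x‖ ^ 2)

theorem model_contDiff {d : ℕ} (c : ℝ) (p y : Ed d) (S : Ed d →L[ℝ] Ed d) (M α : ℝ) :
    ContDiff ℝ 2 (model c p y S M α) := by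
  unfold model
  have h1 : ContDiff ℝ 2 (fun x : Ed d => ‖x‖ ^ 2) := contDiff_norm_sq ℝ
  have h2 : ContDiff ℝ 2 (fun x : Ed d => ⟪p, x - y⟫) :=
    contDiff_const.inner ℝ (contDiff_id.sub contDiff_const)
  have h3 : ContDiff ℝ 2 (fun x : Ed d => ⟪S (x - y), x - y⟫) :=
    (S.contDiff.comp (contDiff_id.sub contDiff_const)).inner ℝ (contDiff_id.sub contDiff_const)
  exact ((contDiff_const.add h2).add h3).add (contDiff_const.mul (contDiff_const.mul h1).exp)

theorem model_fderiv {d : ℕ} (c : ℝ) (p y : Ed d) (S : Ed d →L[ℝ] Ed d) (M α : ℝ) (x b : Ed d) :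
    fderiv ℝ (model c p y S M α) x b = ⟪p, b⟫ + (⟪S (x - y), b⟫ + ⟪S b, x - y⟫)
      - 2 * α * M * Real.exp (-α * ‖x‖ ^ 2) * ⟪x, b⟫ := by
  have hid : HasFDerivAt (fun x : Ed d => x - y) (ContinuousLinearMap.id ℝ (Ed d)) x :=
    (hasFDerivAt_id x).sub_const y
  have hS : HasFDerivAt (fun x : Ed d => S (x - y)) (S.comp (ContinuousLinearMap.id ℝ (Ed d))) x :=
    S.hasFDerivAt.comp x hid
  have h1 := (hasFDerivAt_const p x).inner ℝ hid
  have h2 := hS.inner ℝ hid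
  have h3 := (((hasFDerivAt_id x).norm_sq.const_mul (-α)).exp).const_mul M
  have h := (((h1.const_add c)).add h2).add h3
  have h' : HasFDerivAt (model c p y S M α) _ x := h
  rw [h'.fderiv]
  simp
  ring

theorem model_fderiv2 {d : ℕ} (c : ℝ) (p y : Ed d) (S : Ed d →L[ℝ] Ed d) (M α : ℝ) (a b : Ed d) :
    fderiv ℝ (fderiv ℝ (model c p y S M α)) y a b = ⟪S a, b⟫ + ⟪S b, a⟫
      + M * Real.exp (-α * ‖y‖ ^ 2) * (4 * α ^ 2 * ⟪y, a⟫ * ⟪y, b⟫ - 2 * α * ⟪a, b⟫) := by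
  have hd : DifferentiableAt ℝ (fderiv ℝ (model c p y S M α)) y :=
    ((model_contDiff c p y S M α).fderiv_right (m := 1) (by norm_num)).differentiable (by norm_num) y
  have h0 : fderiv ℝ (fderiv ℝ (model c p y S M α)) y a b
      = fderiv ℝ (fun x => fderiv ℝ (model c p y S M α) x b) y a := by
    have := (hd.hasFDerivAt.clm_apply (hasFDerivAt_const b y)).fderiv
    rw [this]; simp
  rw [h0]
  simp_rw [model_fderiv]
  have hid : HasFDerivAt (fun x : Ed d => x - y) (ContinuousLinearMap.id ℝ (Ed d)) y :=
    (hasFDerivAt_id y).sub_const y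
  have hS : HasFDerivAt (fun x : Ed d => S (x - y)) (S.comp (ContinuousLinearMap.id ℝ (Ed d))) y :=
    S.hasFDerivAt.comp y hid
  have h1 := (hS.inner ℝ (hasFDerivAt_const b y))
  have h2 := (hasFDerivAt_const (S b) y).inner ℝ hid
  have h3 := (((hasFDerivAt_id y).norm_sq.const_mul (-α)).exp).const_mul (2 * α * M)
  have h4 := (hasFDerivAt_id y).inner ℝ (hasFDerivAt_const b y)
  have h := ((h1.add h2).const_add ⟪p, b⟫).sub (h3.mul h4)
  have h' : HasFDerivAt (fun x => ⟪p, b⟫ + (⟪S (x - y), b⟫ + ⟪S b, x - y⟫)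
      - 2 * α * M * Real.exp (-α * ‖x‖ ^ 2) * ⟪x, b⟫) _ y := h
  rw [h'.fderiv]
  simp
  ring

theorem inner_gradient {d : ℕ} (φ : Ed d → ℝ) (x z : Ed d) : ⟪gradient φ x, z⟫ = fderiv ℝ φ x z := by
  simp [gradient]

theorem model_gradient {d : ℕ} (c : ℝ) (p y : Ed d) (S : Ed d →L[ℝ] Ed d) (M α : ℝ) :
    gradient (model c p y S M α) y = p - (2 * α * M * Real.exp (-α * ‖y‖ ^ 2)) • y := by
  refine ext_inner_right ℝ fun z => ?_
  rw [inner_gradient, model_fderiv, inner_sub_left, inner_smul_left]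
  simp

theorem model_hess {d : ℕ} {φ : Ed d → ℝ} {c : ℝ} {p y : Ed d} {S : Ed d →L[ℝ] Ed d} {M α : ℝ}
    (h : φ =ᶠ[nhds y] model c p y S M α) (i j : Fin d) :
    hess φ y i j = ⟪S (EuclideanSpace.single i 1), EuclideanSpace.single j 1⟫
      + ⟪S (EuclideanSpace.single j 1), EuclideanSpace.single i 1⟫
      + M * Real.exp (-α * ‖y‖ ^ 2) * (4 * α ^ 2 * y i * y j - 2 * α * (1 : Matrix (Fin d) (Fin d) ℝ) i j) := by
  rw [hess, Matrix.of_apply, iteratedFDeriv_two_apply, h.fderiv.fderiv_eq]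
  simp only [Matrix.cons_val_zero, Matrix.cons_val_one]
  rw [model_fderiv2]
  have : ⟪(EuclideanSpace.single i (1 : ℝ) : Ed d), EuclideanSpace.single j 1⟫ = (1 : Matrix (Fin d) (Fin d) ℝ) i j := by
    simp [EuclideanSpace.inner_single_left, Matrix.one_apply]
  rw [this]
  simp [EuclideanSpace.inner_single_right]

/-- The trace of an operator. -/
def trOp {d : ℕ} (T : Ed d →L[ℝ] Ed d) : ℝ :=
  ∑ i, ⟪T (EuclideanSpace.single i 1), EuclideanSpace.single i 1⟫

theorem ed_sum {d : ℕ} (x : Fin d → ℝ) (T : Ed d →L[ℝ] Ed d) :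
    ∑ i, ∑ j, x i * ⟪T (EuclideanSpace.single i 1), EuclideanSpace.single j 1⟫ * x j
      = ⟪T (∑ i, x i • EuclideanSpace.single i 1), ∑ i, x i • EuclideanSpace.single i 1⟫ := by
  rw [map_sum, sum_inner]
  refine Finset.sum_congr rfl fun i _ => ?_
  rw [inner_sum]
  refine Finset.sum_congr rfl fun j _ => ?_
  rw [map_smul, inner_smul_left, inner_smul_right]
  simp; ring

theorem elliptic_trace {d : ℕ} {lam Lam : ℝ} {A : Matrix (Fin d) (Fin d) ℝ}
    (hA : A ∈ ellipticSet lam Lam d) {S : Matrix (Fin d) (Fin d) ℝ}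
    (hS : ∀ x : Fin d → ℝ, 0 ≤ ∑ i, ∑ j, x i * S i j * x j) :
    lam * S.trace ≤ (A * S).trace ∧ (A * S).trace ≤ Lam * S.trace := by
  have h1 := trace_psd_nonneg hA.2.1 hS
  have h2 := trace_psd_nonneg hA.2.2 hS
  rw [Matrix.sub_mul, Matrix.trace_sub, Matrix.smul_mul, Matrix.one_mul, Matrix.trace_smul,
    smul_eq_mul] at h1 h2
  constructor <;> linarith

theorem model_pucci {d : ℕ} {lam Lam : ℝ} (hLam : lam ≤ Lam)
    {φ : Ed d → ℝ} {c : ℝ} {p y : Ed d} {T : Ed d →L[ℝ] Ed d} {M α δ : ℝ}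
    (hM : 0 ≤ M) (hα : 0 ≤ α) (hδ : 0 ≤ δ)
    (hT : ∀ v, 0 ≤ ⟪T v, v⟫)
    (h : φ =ᶠ[nhds y] model c p y (T - δ • ContinuousLinearMap.id ℝ (Ed d)) M α) :
    2 * lam * trOp T - 2 * δ * d * Lam +
      M * Real.exp (-α * ‖y‖ ^ 2) * (4 * α ^ 2 * lam * ‖y‖ ^ 2 - 2 * α * d * Lam)
      ≤ pucciMinus lam Lam (hess φ y) := by
  refine pucciMinus_ge hLam fun A hA => ?_
  set Tm : Matrix (Fin d) (Fin d) ℝ :=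
    Matrix.of fun i j => ⟪T (EuclideanSpace.single i 1), EuclideanSpace.single j 1⟫ with hTm
  set Ym : Matrix (Fin d) (Fin d) ℝ := Matrix.of fun i j => y i * y j with hYm
  set e := Real.exp (-α * ‖y‖ ^ 2) with he
  have hid : ∀ i j : Fin d, ⟪(EuclideanSpace.single i (1 : ℝ) : Ed d), EuclideanSpace.single j 1⟫
      = (1 : Matrix (Fin d) (Fin d) ℝ) i j := by
    intro i j
    simp [EuclideanSpace.inner_single_left, Matrix.one_apply]
  have hH : hess φ y = Tm + Tm.transpose - (2 * δ) • (1 : Matrix (Fin d) (Fin d) ℝ)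
      + (M * e) • ((4 * α ^ 2) • Ym - (2 * α) • (1 : Matrix (Fin d) (Fin d) ℝ)) := by
    ext i j
    rw [model_hess h]
    simp only [Matrix.add_apply, Matrix.sub_apply, Matrix.smul_apply, Matrix.transpose_apply, hTm,
      hYm, Matrix.of_apply, smul_eq_mul, _root_.sub_apply, _root_.smul_apply,
      ContinuousLinearMap.id_apply, inner_sub_left, inner_smul_left, hid, ← he]
    have h1 : (1 : Matrix (Fin d) (Fin d) ℝ) j i = (1 : Matrix (Fin d) (Fin d) ℝ) i j := by
      simp [Matrix.one_apply, eq_comm]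
    rw [h1]
    simp
    ring
  have hT1 : ∀ x : Fin d → ℝ, 0 ≤ ∑ i, ∑ j, x i * Tm i j * x j := by
    intro x
    simp only [hTm, Matrix.of_apply]
    rw [ed_sum]; exact hT _
  have hT2 : ∀ x : Fin d → ℝ, 0 ≤ ∑ i, ∑ j, x i * Tm.transpose i j * x j := by
    intro x
    refine (hT1 x).trans (le_of_eq ?_)
    rw [Finset.sum_comm]
    refine Finset.sum_congr rfl fun i _ => Finset.sum_congr rfl fun j _ => ?_
    rw [Matrix.transpose_apply]; ring
  have hY : ∀ x : Fin d → ℝ, 0 ≤ ∑ i, ∑ j, x i * Ym i j * x j := by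
    intro x
    have : ∑ i, ∑ j, x i * Ym i j * x j = (∑ i, x i * y i) ^ 2 := by
      rw [sq, Finset.sum_mul_sum]
      refine Finset.sum_congr rfl fun i _ => Finset.sum_congr rfl fun j _ => ?_
      simp [hYm]; ring
    rw [this]; positivity
  have hI : ∀ x : Fin d → ℝ, 0 ≤ ∑ i, ∑ j, x i * (1 : Matrix (Fin d) (Fin d) ℝ) i j * x j := by
    intro x
    refine Finset.sum_nonneg fun i _ => ?_
    simp [Matrix.one_apply]
    exact mul_self_nonneg _
  have e1 := (elliptic_trace hA hT1).1
  have e2 := (elliptic_trace hA hT2).1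
  have e3 := (elliptic_trace hA hY).1
  have e4 := (elliptic_trace hA hI).2
  have t1 : Tm.trace = trOp T := by simp [Matrix.trace, hTm, trOp]
  have t3 : Ym.trace = ‖y‖ ^ 2 := by
    rw [EuclideanSpace.real_norm_sq_eq]
    simp [Matrix.trace, hYm, sq]
  rw [Matrix.trace_transpose, t1] at e2
  rw [t1] at e1
  rw [t3] at e3
  rw [Matrix.trace_one, Fintype.card_fin] at e4
  rw [hH]
  simp only [Matrix.mul_add, Matrix.mul_sub, Matrix.mul_smul, Matrix.trace_add, Matrix.trace_sub,
    Matrix.trace_smul, smul_eq_mul]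
  have hMe : 0 ≤ M * e := mul_nonneg hM (Real.exp_pos _).le
  have k4 := mul_le_mul_of_nonneg_left e4 (by positivity : 0 ≤ 2 * δ)
  have k5 : 4 * α ^ 2 * lam * ‖y‖ ^ 2 - 2 * α * d * Lam ≤
      4 * α ^ 2 * (A * Ym).trace - 2 * α * (A * 1).trace := by
    have a1 := mul_le_mul_of_nonneg_left e3 (by positivity : 0 ≤ 4 * α ^ 2)
    have a2 := mul_le_mul_of_nonneg_left e4 (by positivity : 0 ≤ 2 * α)
    nlinarith
  have k6 := mul_le_mul_of_nonneg_left k5 hMe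
  nlinarith

set_option maxHeartbeats 4000000 in
theorem contact_ineq {d : ℕ} {lam Lam C0 : ℝ} (hLam : lam ≤ Lam) (hC0 : 0 ≤ C0)
    {K : Ed d → ℝ} (hK : KernCond K) {r : ℝ} (hr : 0 < r) (hr1 : r ≤ 1) {f u : Ed d → ℝ}
    {O : Set (Ed d)} (hu : SupersolExtremal lam Lam C0 r K f O u)
    {M α R : ℝ} (hM : 0 ≤ M) (hα : 1 ≤ α) (hR : 1 ≤ R) {y p : Ed d} (hy : y ∈ O)
    {w : Ed d → ℝ} (hw : ∀ x, w x = u x - M * Real.exp (-α * ‖x‖ ^ 2))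
    (hplane : ∀ v, ‖v‖ ≤ 4 * R → w y + ⟪p, v⟫ ≤ w (y + v))
    (hfar : ∀ v, 2 * R ≤ ‖v‖ → w y ≤ w (y + v))
    {T : Ed d →L[ℝ] Ed d} (hT : ∀ v, 0 ≤ ⟪T v, v⟫)
    (hexp : ∀ δ > 0, ∃ ρ > 0, ∀ v, ‖v‖ ≤ ρ → w y + ⟪p, v⟫ + ⟪T v, v⟫ - δ * ‖v‖ ^ 2 ≤ w (y + v)) :
    f y ≤ -(2 * lam * trOp T) + ((4 * R + 2) * CKer K + C0) * ‖p‖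
      + α * M * Real.exp (-α * ‖y‖ ^ 2) *
        (-(4 * α * lam * ‖y‖ ^ 2) + 2 * d * Lam + CKer K + 2 * C0 * ‖y‖) := by
  set e := Real.exp (-α * ‖y‖ ^ 2) with he
  have hCK := CKer_nonneg hK
  have he0 : 0 < e := Real.exp_pos _
  -- it suffices to have the inequality with an error of order `δ`
  have key : ∀ δ > 0, f y ≤ -(2 * lam * trOp T) + ((4 * R + 2) * CKer K + C0) * ‖p‖
      + α * M * e * (-(4 * α * lam * ‖y‖ ^ 2) + 2 * d * Lam + CKer K + 2 * C0 * ‖y‖)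
      + δ * (2 * d * Lam + (16 * R ^ 2 + 1) * CKer K) := by
    intro δ hδ
    obtain ⟨ρ0, hρ0, hρ⟩ := hexp δ hδ
    set ρ := min ρ0 R with hρdef
    have hρpos : 0 < ρ := lt_min hρ0 (by linarith)
    let χ₁ : ContDiffBump (0 : Ed d) := ⟨2 * R, 4 * R, by linarith, by linarith⟩
    let χ₂ : ContDiffBump (0 : Ed d) := ⟨ρ / 2, ρ, by linarith, by linarith⟩
    let θ : Ed d → ℝ := fun v => χ₁ v * (⟪p, v⟫ - δ * ‖v‖ ^ 2) + χ₂ v * ⟪T v, v⟫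
    let φ : Ed d → ℝ := fun x => w y + θ (x - y) + M * Real.exp (-α * ‖x‖ ^ 2)
    have hθ0 : θ 0 = 0 := by simp [θ]
    have hχ1 : ∀ v : Ed d, ‖v‖ ≤ 2 * R → χ₁ v = 1 := fun v hv =>
      χ₁.one_of_mem_closedBall (by simpa using hv)
    have hχ1' : ∀ v : Ed d, 4 * R ≤ ‖v‖ → χ₁ v = 0 := fun v hv =>
      χ₁.zero_of_le_dist (by simpa using hv)
    have hχ2 : ∀ v : Ed d, ‖v‖ ≤ ρ / 2 → χ₂ v = 1 := fun v hv =>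
      χ₂.one_of_mem_closedBall (by simpa using hv)
    have hχ2' : ∀ v : Ed d, ρ ≤ ‖v‖ → χ₂ v = 0 := fun v hv =>
      χ₂.zero_of_le_dist (by simpa using hv)
    have hpv : ∀ v, |⟪p, v⟫| ≤ ‖p‖ * ‖v‖ := fun v => abs_real_inner_le_norm p v
    -- lower bound of θ
    have hθlow : ∀ v, χ₁ v * (⟪p, v⟫ - δ * ‖v‖ ^ 2) ≤ θ v := fun v => by
      have : 0 ≤ χ₂ v * ⟪T v, v⟫ := mul_nonneg χ₂.nonneg (hT v)
      simp only [θ]; linarith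
    -- θ is below w
    have hθup : ∀ v, w y + θ v ≤ w (y + v) := by
      intro v
      rcases le_or_gt ‖v‖ ρ with h1 | h1
      · have hvR : ‖v‖ ≤ R := h1.trans (min_le_right _ _)
        have h2 := hρ v (h1.trans (min_le_left _ _))
        have h3 : χ₂ v * ⟪T v, v⟫ ≤ ⟪T v, v⟫ := mul_le_of_le_one_left (hT v) χ₂.le_one
        simp only [θ]
        rw [hχ1 v (by linarith)]
        linarith
      · simp only [θ]
        rw [hχ2' v h1.le, zero_mul, add_zero]
        rcases le_or_gt ‖v‖ (2 * R) with h2 | h2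
        · rw [hχ1 v h2]
          have := hplane v (by linarith)
          have : 0 ≤ δ * ‖v‖ ^ 2 := by positivity
          linarith
        · rcases le_or_gt ‖v‖ (4 * R) with h3 | h3
          · have a1 := hplane v h3
            have a2 := hfar v h2.le
            have b1 : (0 : ℝ) ≤ χ₁ v := χ₁.nonneg
            have b2 : χ₁ v ≤ 1 := χ₁.le_one
            have : 0 ≤ δ * ‖v‖ ^ 2 := by positivity
            nlinarith
          · rw [hχ1' v h3.le]
            have a2 := hfar v h2.le
            linarith
    have hθsmooth : ContDiff ℝ 2 θ := by
      have h1 : ContDiff ℝ 2 (fun x : Ed d => ‖x‖ ^ 2) := contDiff_norm_sq ℝ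
      have h2 : ContDiff ℝ 2 (fun x : Ed d => ⟪p, x⟫) := contDiff_const.inner ℝ contDiff_id
      have h3 : ContDiff ℝ 2 (fun x : Ed d => ⟪T x, x⟫) := T.contDiff.inner ℝ contDiff_id
      exact (χ₁.contDiff.mul (h2.sub (contDiff_const.mul h1))).add (χ₂.contDiff.mul h3)
    have hθsupp : HasCompactSupport θ := by
      refine HasCompactSupport.add ?_ ?_
      · exact HasCompactSupport.mul_right χ₁.hasCompactSupport
      · exact HasCompactSupport.mul_right χ₂.hasCompactSupport
    have hφsmooth : ContDiff ℝ 2 φ := by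
      have h1 : ContDiff ℝ 2 (fun x : Ed d => ‖x‖ ^ 2) := contDiff_norm_sq ℝ
      exact (contDiff_const.add (hθsmooth.comp (contDiff_id.sub contDiff_const))).add
        (contDiff_const.mul (contDiff_const.mul h1).exp)
    have hφbdd : IsBddFun φ := by
      obtain ⟨B, hB⟩ := hθsupp.exists_bound_of_continuous hθsmooth.continuous
      refine ⟨|w y| + B + M, fun x => ?_⟩
      have h1 := hB (x - y)
      rw [Real.norm_eq_abs] at h1
      have h2 : Real.exp (-α * ‖x‖ ^ 2) ≤ 1 := Real.exp_le_one_iff.mpr (by nlinarith [sq_nonneg ‖x‖])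
      have h3 : |M * Real.exp (-α * ‖x‖ ^ 2)| ≤ M := by
        rw [abs_of_nonneg (by positivity)]
        exact mul_le_of_le_one_right hM h2
      calc |φ x| ≤ |w y + θ (x - y)| + |M * Real.exp (-α * ‖x‖ ^ 2)| := abs_add_le _ _
        _ ≤ _ := by
          have := abs_add_le (w y) (θ (x - y))
          linarith
    have hφu : ∀ x, φ x ≤ u x := by
      intro x
      have := hθup (x - y)
      rw [add_sub_cancel, hw x] at this
      simp only [φ]; linarith
    have hφy : u y = φ y := by
      simp only [φ, sub_self, hθ0, add_zero, hw y]; ring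
    have hmodel : φ =ᶠ[nhds y] model (w y) p y (T - δ • ContinuousLinearMap.id ℝ (Ed d)) M α := by
      filter_upwards [Metric.closedBall_mem_nhds y (half_pos hρpos)] with x hx
      rw [mem_closedBall, dist_eq_norm] at hx
      have hρR : ρ ≤ R := min_le_right _ _
      simp only [φ, θ, model]
      rw [hχ1 _ (by linarith), hχ2 _ hx]
      simp only [_root_.sub_apply, _root_.smul_apply, ContinuousLinearMap.id_apply, inner_sub_left (T _),
        inner_smul_left, real_inner_self_eq_norm_sq]
      simp
      ring
    have hmain := hu φ hφsmooth hφbdd y hy hφu hφy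
    have hP := model_pucci hLam hM (by linarith : (0:ℝ) ≤ α) hδ.le hT hmodel
    have hgrad : gradient φ y = p - (2 * α * M * e) • y := by
      have : gradient φ y = gradient (model (w y) p y (T - δ • ContinuousLinearMap.id ℝ (Ed d)) M α) y := by
        rw [gradient, gradient, hmodel.fderiv_eq]
      rw [this, model_gradient]
    have hgn : ‖gradient φ y‖ ≤ ‖p‖ + 2 * α * M * e * ‖y‖ := by
      rw [hgrad]
      refine (norm_sub_le _ _).trans ?_
      rw [norm_smul, Real.norm_of_nonneg (by positivity)]
    have hr1' : 1 ≤ 1 / r := by rw [le_div_iff₀ hr]; linarith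
    have hr2 : 1 ≤ 1 / r ^ 2 := by
      rw [le_div_iff₀ (by positivity)]; nlinarith
    have hnl : -nlMinus K r φ y ≤ ((4 * R + 2) * ‖p‖ + (16 * R ^ 2 + 1) * δ + α * M * e) * CKer K := by
      refine nl_bound hK hr (by positivity) fun z => ?_
      -- the increment of the Gaussian
      have hG : -(α * M * e * ‖z‖ ^ 2) ≤ M * Real.exp (-α * ‖y + z‖ ^ 2) - M * e
          + 2 * α * M * e * ⟪y, z⟫ := by
        have h1 : Real.exp (-α * ‖y + z‖ ^ 2) = e * Real.exp (-α * (2 * ⟪y, z⟫ + ‖z‖ ^ 2)) := by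
          rw [he, ← Real.exp_add, norm_add_sq_real]; ring_nf
        have h2 := Real.add_one_le_exp (-α * (2 * ⟪y, z⟫ + ‖z‖ ^ 2))
        have h3 := mul_le_mul_of_nonneg_left h2 (by positivity : 0 ≤ M * e)
        rw [h1]; nlinarith
      have hφz : φ (y + z) = w y + θ z + M * Real.exp (-α * ‖y + z‖ ^ 2) := by
        simp only [φ, add_sub_cancel_left]
      have hφ0 : φ y = w y + M * e := by simp only [φ, sub_self, hθ0, he]; ring
      rw [deltaOp, hφz, hφ0]
      have hpz := abs_le.mp (hpv z)
      have hχ0 : (0 : ℝ) ≤ χ₁ z := χ₁.nonneg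
      have hχle : χ₁ z ≤ 1 := χ₁.le_one
      have hpn : 0 ≤ ‖p‖ := norm_nonneg p
      have hzn : 0 ≤ ‖z‖ := norm_nonneg z
      by_cases hz : ‖z‖ < 1 / r
      · rw [indicator_of_mem (by simpa using hz), hgrad, inner_sub_left, inner_smul_left]
        have hmin : min (‖z‖ ^ 2) (1 / r ^ 2) = ‖z‖ ^ 2 := by
          rw [min_eq_left]
          rw [← one_div_pow]
          exact pow_le_pow_left₀ (norm_nonneg z) hz.le 2
        rw [hmin]
        have hθz : -(((4 * R + 2) * ‖p‖ + (16 * R ^ 2 + 1) * δ) * ‖z‖ ^ 2) ≤ θ z - ⟪p, z⟫ := by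
          have hl := hθlow z
          have hz2 : 0 ≤ ‖z‖ ^ 2 := by positivity
          have hR2 : 0 ≤ R ^ 2 := by positivity
          rcases le_or_gt ‖z‖ (2 * R) with h2 | h2
          · rw [hχ1 z h2] at hl
            have e1 : 0 ≤ (4 * R + 2) * ‖p‖ * ‖z‖ ^ 2 := by positivity
            have e2 : 0 ≤ 16 * R ^ 2 * δ * ‖z‖ ^ 2 := by positivity
            nlinarith
          · have hz1 : ‖z‖ ≤ ‖z‖ ^ 2 := by nlinarith
            have e0 : -(‖p‖ * ‖z‖ + δ * ‖z‖ ^ 2) ≤ χ₁ z * (⟪p, z⟫ - δ * ‖z‖ ^ 2) := by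
              have : 0 ≤ ‖p‖ * ‖z‖ + δ * ‖z‖ ^ 2 := by positivity
              nlinarith
            have e1 : ‖p‖ * ‖z‖ ≤ ‖p‖ * ‖z‖ ^ 2 := mul_le_mul_of_nonneg_left hz1 hpn
            have e2 : 0 ≤ 16 * R ^ 2 * δ * ‖z‖ ^ 2 := by positivity
            have e3 : 0 ≤ 4 * R * ‖p‖ * ‖z‖ ^ 2 := by positivity
            nlinarith
        simp only [conj_trivial]
        nlinarith
      · rw [indicator_of_notMem (by simpa using hz)]
        have hz' : 1 / r ≤ ‖z‖ := not_lt.mp hz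
        have hmin : min (‖z‖ ^ 2) (1 / r ^ 2) = 1 / r ^ 2 := by
          rw [min_eq_right]
          rw [← one_div_pow]
          exact pow_le_pow_left₀ (by positivity) hz' 2
        rw [hmin]
        have hθz : -((4 * R + 2) * ‖p‖ + (16 * R ^ 2 + 1) * δ) ≤ θ z := by
          have hl := hθlow z
          rcases le_or_gt ‖z‖ (4 * R) with h2 | h2
          · have e0 : -(‖p‖ * ‖z‖ + δ * ‖z‖ ^ 2) ≤ χ₁ z * (⟪p, z⟫ - δ * ‖z‖ ^ 2) := by
              have : 0 ≤ ‖p‖ * ‖z‖ + δ * ‖z‖ ^ 2 := by positivity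
              nlinarith
            have e1 : ‖p‖ * ‖z‖ ≤ ‖p‖ * (4 * R) := mul_le_mul_of_nonneg_left h2 hpn
            have e2 : ‖z‖ ^ 2 ≤ 16 * R ^ 2 := by nlinarith
            have e3 : δ * ‖z‖ ^ 2 ≤ δ * (16 * R ^ 2) := mul_le_mul_of_nonneg_left e2 hδ.le
            nlinarith
          · rw [hχ1' z h2.le, zero_mul] at hl
            have : 0 ≤ (4 * R + 2) * ‖p‖ + (16 * R ^ 2 + 1) * δ := by positivity
            linarith
        have hMe : M * e ≤ α * M * e := by nlinarith [mul_nonneg hM he0.le]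
        have hMx : 0 ≤ M * Real.exp (-α * ‖y + z‖ ^ 2) := by positivity
        have hS : 0 ≤ (4 * R + 2) * ‖p‖ + (16 * R ^ 2 + 1) * δ + α * M * e := by positivity
        have := mul_le_mul_of_nonneg_left hr2 hS
        linarith
    have hC0r : C0 * r * ‖gradient φ y‖ ≤ C0 * (‖p‖ + 2 * α * M * e * ‖y‖) := by
      have h1 : C0 * r ≤ C0 := mul_le_of_le_one_right hC0 hr1
      exact mul_le_mul h1 hgn (norm_nonneg _) hC0
    nlinarith
  refine le_of_forall_pos_le_add fun η hη => ?_
  set D := 2 * d * Lam + (16 * R ^ 2 + 1) * CKer K with hD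
  have h1 := key (η / (|D| + 1)) (by positivity)
  have h2 : η / (|D| + 1) * D ≤ η := by
    rw [div_mul_eq_mul_div, div_le_iff₀ (by positivity)]
    have := le_abs_self D
    nlinarith
  linarith

/-- density of `X` at `x` in the sense of approximability of nearby points -/
def DensAt {d : ℕ} (X : Set (Ed d)) (x : Ed d) : Prop :=
  ∀ η > 0, ∃ ρ > 0, ∀ v : Ed d, ‖v‖ ≤ ρ → ∃ x' ∈ X, ‖x' - (x + v)‖ ≤ η * ‖v‖

theorem densAt_ae {d : ℕ} {X : Set (Ed d)} (hX : MeasurableSet X) :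
    ∀ᵐ x ∂(volume.restrict X), DensAt X x := by
  filter_upwards [Besicovitch.ae_tendsto_measure_inter_div (volume : Measure (Ed d)) X,
    ae_restrict_mem hX] with x hx hxX
  intro η hη
  set c : ℝ := (η / (1 + η)) ^ d with hc
  have hc0 : 0 < c := by positivity
  have h1 : (1 : ℝ≥0∞) - ENNReal.ofReal c < 1 :=
    ENNReal.sub_lt_self (by simp) (by simp) (by simpa using hc0)
  have h2 := hx.eventually (lt_mem_nhds h1)
  rw [eventually_nhdsWithin_iff, Metric.eventually_nhds_iff] at h2
  obtain ⟨t, ht, h2⟩ := h2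
  refine ⟨t / (2 * (1 + η)), by positivity, fun v hv => ?_⟩
  by_cases hv0 : v = 0
  · exact ⟨x, hxX, by simp [hv0]⟩
  have hvp : 0 < ‖v‖ := norm_pos_iff.mpr hv0
  by_contra hcon
  push Not at hcon
  set s := (1 + η) * ‖v‖ with hs
  have hsp : 0 < s := by positivity
  have hst : s < t := by
    rw [le_div_iff₀ (by positivity)] at hv
    nlinarith
  have h3 := h2 (y := s) (by rw [Real.dist_eq, sub_zero, abs_of_pos hsp]; exact hst) hsp
  have hsub : closedBall (x + v) (η * ‖v‖) ⊆ closedBall x s := by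
    intro z hz
    rw [mem_closedBall, dist_eq_norm] at *
    have : z - x = (z - (x + v)) + v := by abel
    rw [this]
    refine (norm_add_le _ _).trans ?_
    rw [hs]; linarith
  have hdisj : Disjoint (X ∩ closedBall x s) (closedBall (x + v) (η * ‖v‖)) := by
    rw [Set.disjoint_left]
    intro z hz hz'
    rw [mem_closedBall, dist_eq_norm] at hz'
    exact absurd hz' (not_le.mpr (hcon z hz.1))
  have hadd : volume (X ∩ closedBall x s) + volume (closedBall (x + v) (η * ‖v‖)) ≤
      volume (closedBall x s) := by
    rw [← measure_union hdisj measurableSet_closedBall]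
    exact measure_mono (union_subset inter_subset_right hsub)
  have hvol : volume (closedBall (x + v) (η * ‖v‖)) = ENNReal.ofReal c * volume (closedBall x s) := by
    rw [Measure.addHaar_closedBall _ _ (by positivity), Measure.addHaar_closedBall _ _ hsp.le, ← mul_assoc,
      ← ENNReal.ofReal_mul hc0.le]
    congr 2
    simp only [finrank_euclideanSpace, Fintype.card_fin, hc, hs]
    rw [← mul_pow]
    congr 1
    field_simp
  rw [hvol] at hadd
  have hb0 : volume (closedBall x s) ≠ 0 := (measure_closedBall_pos _ _ hsp).ne'
  have hbt : volume (closedBall x s) ≠ ⊤ := measure_closedBall_lt_top.ne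
  rw [ENNReal.lt_div_iff_mul_lt (Or.inl hb0) (Or.inl hbt)] at h3
  have h4 : (1 - ENNReal.ofReal c) * volume (closedBall x s) =
      volume (closedBall x s) - ENNReal.ofReal c * volume (closedBall x s) := by
    rw [ENNReal.sub_mul (fun _ _ => hbt), one_mul]
  rw [h4] at h3
  have h5 := ENNReal.le_sub_of_add_le_right (ENNReal.mul_ne_top ENNReal.ofReal_ne_top hbt) hadd
  exact absurd h3 (not_lt.mpr h5)

theorem lip_image_le {d : ℕ} {G : Ed d → Ed d} {C : NNReal} (hG : LipschitzWith C G)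
    {A : Set (Ed d)} (hA : MeasurableSet A) :
    volume (G '' A) ≤ ∫⁻ x in A, ENNReal.ofReal |(fderiv ℝ G x).det| := by
  set D := {x | DifferentiableAt ℝ G x} with hD
  have hDm : MeasurableSet D := measurableSet_of_differentiableAt ℝ G
  have hD0 : volume Dᶜ = 0 := by
    have := hG.ae_differentiableAt (μ := (volume : Measure (Ed d)))
    exact this
  have h0 : volume (G '' Dᶜ) = 0 := by
    have e1 : (volume : Measure (Ed d)) ≪ Measure.hausdorffMeasure (Module.finrank ℝ (Ed d)) :=
      Measure.absolutelyContinuous_isAddHaarMeasure _ _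
    have e2 : (Measure.hausdorffMeasure (Module.finrank ℝ (Ed d)) : Measure (Ed d)) ≪ volume :=
      Measure.absolutelyContinuous_isAddHaarMeasure _ _
    apply e1
    have := hG.hausdorffMeasure_image_le (d := (Module.finrank ℝ (Ed d) : ℝ)) (by positivity) Dᶜ
    rw [e2 hD0, mul_zero] at this
    exact le_antisymm this bot_le
  have hsub : G '' A ⊆ G '' (A ∩ D) ∪ G '' Dᶜ := by
    rw [← image_union]
    apply image_mono
    intro x hx
    by_cases h : x ∈ D
    · exact Or.inl ⟨hx, h⟩
    · exact Or.inr h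
  calc volume (G '' A) ≤ volume (G '' (A ∩ D)) + volume (G '' Dᶜ) :=
        (measure_mono hsub).trans (measure_union_le _ _)
    _ = volume (G '' (A ∩ D)) := by rw [h0, add_zero]
    _ ≤ ∫⁻ x in A ∩ D, ENNReal.ofReal |(fderiv ℝ G x).det| :=
        addHaar_image_le_lintegral_abs_det_fderiv volume (hA.inter hDm)
          (fun x hx => (hx.2 : DifferentiableAt ℝ G x).hasFDerivAt.hasFDerivWithinAt)
    _ ≤ _ := lintegral_mono_set inter_subset_left

theorem det_bound {d : ℕ} {B : Ed d →L[ℝ] Ed d}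
    (hB : ∀ a b, ⟪B a, b⟫ ≤ ⟪B a, a⟫ + ⟪B b, b⟫) :
    |B.det| ≤ (d.factorial : ℝ) * trOp B ^ d := by
  have hpos : ∀ a, 0 ≤ ⟪B a, a⟫ := fun a => by simpa using hB a 0
  have hent : ∀ i j : Fin d, |⟪B (EuclideanSpace.single i 1), EuclideanSpace.single j (1:ℝ)⟫| ≤ trOp B := by
    intro i j
    set F : Fin d → ℝ := fun i => ⟪B (EuclideanSpace.single i 1), EuclideanSpace.single i (1:ℝ)⟫ with hF
    have hF0 : ∀ i, 0 ≤ F i := fun i => hpos _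
    have htr : trOp B = ∑ i, F i := rfl
    by_cases hij : i = j
    · subst hij
      rw [abs_of_nonneg (hpos _), htr]
      exact Finset.single_le_sum (f := F) (fun k _ => hF0 k) (Finset.mem_univ i)
    · have h1 := hB (EuclideanSpace.single i 1) (EuclideanSpace.single j 1)
      have h2 := hB (-EuclideanSpace.single i 1) (EuclideanSpace.single j 1)
      simp only [map_neg, inner_neg_left, inner_neg_right, neg_neg] at h2
      have h3 : F i + F j ≤ trOp B := by
        rw [htr, ← Finset.sum_pair hij]
        exact Finset.sum_le_sum_of_subset_of_nonneg (Finset.subset_univ _) (fun k _ _ => hF0 k)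
      rw [abs_le]
      constructor
      · simp only [hF] at h3; linarith
      · simp only [hF] at h3; linarith
  let b := (EuclideanSpace.basisFun (Fin d) ℝ).toBasis
  have h1 : B.det = (LinearMap.toMatrix b b (B : Ed d →ₗ[ℝ] Ed d)).det := by
    rw [LinearMap.det_toMatrix]
  rw [h1]
  have h2 := Matrix.det_le (A := LinearMap.toMatrix b b (B : Ed d →ₗ[ℝ] Ed d))
    (abv := AbsoluteValue.abs) (x := trOp B) (fun i j => by
      rw [LinearMap.toMatrix_apply]
      have := hent j i
      simp only [EuclideanSpace.inner_single_right] at this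
      simpa [b] using this)
  simpa [nsmul_eq_mul] using h2

/-- `𝒢` consists of pairs (contact point, slope) for `w`. -/
def SubG {d : ℕ} (w : Ed d → ℝ) (R : ℝ) (Gr : Set (Ed d × Ed d)) : Prop :=
  ∀ q ∈ Gr, ‖q.1‖ ≤ R ∧ ∀ z, ‖z‖ ≤ 5 * R → w q.1 + ⟪q.2, z - q.1⟫ ≤ w z

theorem SubG.pair {d : ℕ} {w : Ed d → ℝ} {R : ℝ} {Gr : Set (Ed d × Ed d)} (h : SubG w R Gr)
    (hR : 0 < R) {q q' : Ed d × Ed d} (hq : q ∈ Gr) (hq' : q' ∈ Gr) :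
    w q.1 + ⟪q.2, q'.1 - q.1⟫ ≤ w q'.1 :=
  (h q hq).2 q'.1 ((h q' hq').1.trans (by linarith))

theorem SubG.lip {d : ℕ} {w : Ed d → ℝ} {R : ℝ} {Gr : Set (Ed d × Ed d)} (h : SubG w R Gr)
    (hR : 0 < R) {ε : ℝ} (hε : 0 < ε) {q q' : Ed d × Ed d} (hq : q ∈ Gr) (hq' : q' ∈ Gr) :
    ‖q.2 - q'.2‖ ≤ (1 / ε) * ‖(q.1 + ε • q.2) - (q'.1 + ε • q'.2)‖ := by
  have h1 := h.pair hR hq hq'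
  have h2 := h.pair hR hq' hq
  have h3 : ε * ‖q.2 - q'.2‖ ^ 2 ≤ ⟪q.2 - q'.2, (q.1 + ε • q.2) - (q'.1 + ε • q'.2)⟫ := by
    have e1 : (q.1 + ε • q.2) - (q'.1 + ε • q'.2) = (q.1 - q'.1) + ε • (q.2 - q'.2) := by
      rw [smul_sub]; abel
    rw [e1, inner_add_right, inner_smul_right, real_inner_self_eq_norm_sq, inner_sub_left]
    have e2 : q'.1 - q.1 = -(q.1 - q'.1) := by abel
    rw [e2, inner_neg_right] at h1
    linarith
  have h4 := real_inner_le_norm (q.2 - q'.2) ((q.1 + ε • q.2) - (q'.1 + ε • q'.2))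
  rw [div_mul_eq_mul_div, one_mul, le_div_iff₀ hε]
  rcases eq_or_lt_of_le (norm_nonneg (q.2 - q'.2)) with h0 | h0
  · rw [← h0]; simp
  · by_contra hcon
    push Not at hcon
    nlinarith

theorem SubG.exists_map {d : ℕ} {w : Ed d → ℝ} {R : ℝ} {Gr : Set (Ed d × Ed d)} (h : SubG w R Gr)
    (hR : 0 < R) {ε : ℝ} (hε : 0 < ε) :
    ∃ (C : NNReal) (G : Ed d → Ed d), LipschitzWith C G ∧ ∀ q ∈ Gr, G (q.1 + ε • q.2) = q.2 := by
  classical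
  set X := (fun q : Ed d × Ed d => q.1 + ε • q.2) '' Gr with hX
  let G0 : Ed d → Ed d := fun x => if hx : ∃ q ∈ Gr, q.1 + ε • q.2 = x then hx.choose.2 else 0
  have hG0 : ∀ q ∈ Gr, G0 (q.1 + ε • q.2) = q.2 := by
    intro q hq
    have hx : ∃ q' ∈ Gr, q'.1 + ε • q'.2 = q.1 + ε • q.2 := ⟨q, hq, rfl⟩
    simp only [G0]
    rw [dif_pos hx]
    have h1 := h.lip hR hε hx.choose_spec.1 hq
    rw [hx.choose_spec.2, sub_self, norm_zero, mul_zero] at h1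
    exact sub_eq_zero.mp (norm_le_zero_iff.mp h1)
  have hL : LipschitzOnWith (Real.toNNReal (1 / ε)) G0 X := by
    apply LipschitzOnWith.of_dist_le_mul
    rintro _ ⟨q, hq, rfl⟩ _ ⟨q', hq', rfl⟩
    simp only
    rw [hG0 q hq, hG0 q' hq', dist_eq_norm, dist_eq_norm, Real.coe_toNNReal _ (by positivity)]
    exact h.lip hR hε hq hq'
  obtain ⟨G, hG, hGX⟩ := hL.extend_finite_dimension
  exact ⟨_, G, hG, fun q hq => by rw [← hGX ⟨q, hq, rfl⟩, hG0 q hq]⟩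

section pointwise
variable {d : ℕ} {w : Ed d → ℝ} {R : ℝ} {Gr : Set (Ed d × Ed d)} {ε : ℝ} {G : Ed d → Ed d}
  {B : Ed d →L[ℝ] Ed d} {q : Ed d × Ed d}

theorem SubG.cyc (h : SubG w R Gr) (hR : 0 < R) (hε : 0 < ε)
    (hG : ∀ q ∈ Gr, G (q.1 + ε • q.2) = q.2) {x0 x1 x2 : Ed d}
    (h0 : x0 ∈ (fun q : Ed d × Ed d => q.1 + ε • q.2) '' Gr)
    (h1 : x1 ∈ (fun q : Ed d × Ed d => q.1 + ε • q.2) '' Gr)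
    (h2 : x2 ∈ (fun q : Ed d × Ed d => q.1 + ε • q.2) '' Gr) :
    ⟪G x1 - G x0, x2 - x0⟫ ≤ ⟪G x1 - G x0, x1 - x0⟫ + ⟪G x2 - G x0, x2 - x0⟫ := by
  obtain ⟨⟨y0, p0⟩, hq0, rfl⟩ := h0
  obtain ⟨⟨y1, p1⟩, hq1, rfl⟩ := h1
  obtain ⟨⟨y2, p2⟩, hq2, rfl⟩ := h2
  have e0 := hG _ hq0
  have e1 := hG _ hq1
  have e2 := hG _ hq2
  have a0 := h.pair hR hq0 hq1
  have a1 := h.pair hR hq1 hq2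
  have a2 := h.pair hR hq2 hq0
  simp only at e0 e1 e2 a0 a1 a2 ⊢
  rw [e0, e1, e2]
  set P1 := p1 - p0 with hP1
  set P2 := p2 - p0 with hP2
  set Y1 := y1 - y0 with hY1
  set Y2 := y2 - y0 with hY2
  have f1 : y1 + ε • p1 - (y0 + ε • p0) = Y1 + ε • P1 := by rw [hY1, hP1, smul_sub]; abel
  have f2 : y2 + ε • p2 - (y0 + ε • p0) = Y2 + ε • P2 := by rw [hY2, hP2, smul_sub]; abel
  have g1 : y2 - y1 = Y2 - Y1 := by rw [hY1, hY2]; abel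
  have g2 : y0 - y2 = -Y2 := by rw [hY2]; abel
  have g3 : p1 = p0 + P1 := by rw [hP1]; abel
  have g4 : p2 = p0 + P2 := by rw [hP2]; abel
  rw [f1, f2]
  rw [g1, g3, inner_add_left, inner_sub_right p0 Y2 Y1, inner_sub_right P1 Y2 Y1] at a1
  rw [g2, g4, inner_add_left, inner_neg_right, inner_neg_right] at a2
  simp only [inner_add_right, inner_smul_right, real_inner_self_eq_norm_sq]
  have c1 := norm_sub_sq_real P1 P2
  have c2 := sq_nonneg ‖P1 - P2‖
  have c3 : 0 ≤ ε * (‖P1‖ ^ 2 - ⟪P1, P2⟫ + ‖P2‖ ^ 2) := by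
    apply mul_nonneg hε.le
    nlinarith [sq_nonneg ‖P1‖, sq_nonneg ‖P2‖]
  linarith

theorem DensAt.exists_seq {X : Set (Ed d)} {x : Ed d} (h : DensAt X x) (a : Ed d) :
    ∃ xs : ℕ → Ed d, (∀ᶠ n in Filter.atTop, xs n ∈ X) ∧
      Filter.Tendsto (fun n : ℕ => ((n : ℝ) + 1) • (xs n - x)) Filter.atTop (nhds a) := by
  classical
  -- for each η, eventually a good point
  have h1 : ∀ η > 0, ∀ᶠ n : ℕ in Filter.atTop, ∃ x' ∈ X, ‖((n : ℝ) + 1) • (x' - x) - a‖ ≤ η := by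
    intro η hη
    obtain ⟨ρ, hρ, h2⟩ := h (η / (‖a‖ + 1)) (by positivity)
    have h3 : Filter.Tendsto (fun n : ℕ => (1 / ((n : ℝ) + 1)) * ‖a‖) Filter.atTop (nhds (0 * ‖a‖)) :=
      tendsto_one_div_add_atTop_nhds_zero_nat.mul_const _
    rw [zero_mul] at h3
    filter_upwards [h3.eventually (gt_mem_nhds hρ)] with n hn
    have hn1 : (0 : ℝ) < (n : ℝ) + 1 := by positivity
    obtain ⟨x', hx', h4⟩ := h2 ((1 / ((n : ℝ) + 1)) • a) (by
      rw [norm_smul, Real.norm_of_nonneg (by positivity)]; exact hn.le)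
    refine ⟨x', hx', ?_⟩
    have e1 : ((n : ℝ) + 1) • (x' - x) - a = ((n : ℝ) + 1) • (x' - (x + (1 / ((n : ℝ) + 1)) • a)) := by
      have : x' - (x + (1 / ((n : ℝ) + 1)) • a) = (x' - x) - (1 / ((n : ℝ) + 1)) • a := by abel
      rw [this, smul_sub _ (x' - x), smul_smul, mul_one_div_cancel hn1.ne', one_smul]
    rw [e1, norm_smul, Real.norm_of_nonneg hn1.le]
    rw [norm_smul, Real.norm_of_nonneg (by positivity)] at h4
    calc _ ≤ ((n : ℝ) + 1) * (η / (‖a‖ + 1) * (1 / ((n : ℝ) + 1) * ‖a‖)) := by gcongr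
      _ = η * (‖a‖ / (‖a‖ + 1)) := by field_simp
      _ ≤ η * 1 := by
        gcongr
        rw [div_le_one (by positivity)]; linarith
      _ = η := mul_one η
  -- choose nearly optimal points
  have h2 : ∀ n : ℕ, ∃ x', (X.Nonempty → x' ∈ X) ∧ ∀ z ∈ X,
      ‖((n : ℝ) + 1) • (x' - x) - a‖ ≤ ‖((n : ℝ) + 1) • (z - x) - a‖ + 1 / ((n : ℝ) + 1) := by
    intro n
    by_cases hne : X.Nonempty
    · set S := (fun z => ‖((n : ℝ) + 1) • (z - x) - a‖) '' X with hS
      have hbd : BddBelow S := ⟨0, by rintro _ ⟨z, _, rfl⟩; positivity⟩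
      have hn1 : (0 : ℝ) < 1 / ((n : ℝ) + 1) := by positivity
      obtain ⟨_, ⟨x', hx', rfl⟩, h3⟩ := exists_lt_of_csInf_lt (hne.image _)
        (lt_add_of_pos_right (sInf S) hn1)
      refine ⟨x', fun _ => hx', fun z hz => h3.le.trans ?_⟩
      have := csInf_le hbd ⟨z, hz, rfl⟩
      linarith
    · exact ⟨0, fun hh => absurd hh hne, fun z hz => absurd ⟨z, hz⟩ hne⟩
  choose xs hxs1 hxs2 using h2
  refine ⟨xs, ?_, ?_⟩
  · filter_upwards [h1 1 one_pos] with n hn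
    obtain ⟨x', hx', _⟩ := hn
    exact hxs1 n ⟨x', hx'⟩
  · rw [Metric.tendsto_atTop']
    intro η hη
    have h3 := (tendsto_one_div_add_atTop_nhds_zero_nat (𝕜 := ℝ)).eventually
      (gt_mem_nhds (by positivity : 0 < η / 2))
    obtain ⟨N, hN⟩ := Filter.eventually_atTop.mp (h3.and (h1 (η / 3) (by positivity)))
    refine ⟨N, fun n hn => ?_⟩
    obtain ⟨h4, x', hx', h5⟩ := hN n hn.le
    rw [dist_eq_norm]
    have := hxs2 n x' hx'
    linarith

theorem SubG.cycB (h : SubG w R Gr) (hR : 0 < R) (hε : 0 < ε)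
    (hG : ∀ q ∈ Gr, G (q.1 + ε • q.2) = q.2) {x : Ed d}
    (hx : x ∈ (fun q : Ed d × Ed d => q.1 + ε • q.2) '' Gr)
    (hD : DensAt ((fun q : Ed d × Ed d => q.1 + ε • q.2) '' Gr) x) (hB : HasFDerivAt G B x)
    (a b : Ed d) : ⟪B a, b⟫ ≤ ⟪B a, a⟫ + ⟪B b, b⟫ := by
  obtain ⟨xa, ha1, ha2⟩ := hD.exists_seq a
  obtain ⟨xb, hb1, hb2⟩ := hD.exists_seq b
  have key : ∀ (v : Ed d) (xs : ℕ → Ed d),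
      Filter.Tendsto (fun n : ℕ => ((n : ℝ) + 1) • (xs n - x)) Filter.atTop (nhds v) →
      Filter.Tendsto (fun n : ℕ => ((n : ℝ) + 1) • (G (xs n) - G x)) Filter.atTop (nhds (B v)) := by
    intro v xs hxs
    have h0 : Filter.Tendsto (fun n => xs n - x) Filter.atTop (nhds 0) := by
      have h1 := (tendsto_one_div_add_atTop_nhds_zero_nat (𝕜 := ℝ)).smul hxs
      rw [zero_smul] at h1
      refine h1.congr fun n => ?_
      have hn1 : ((n : ℝ) + 1) ≠ 0 := by positivity
      rw [smul_smul, one_div_mul_cancel hn1, one_smul]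
    have := (hasFDerivWithinAt_univ.2 hB).lim h0 (Filter.Eventually.of_forall fun _ => mem_univ _) hxs
    simpa using this
  have ka := key a xa ha2
  have kb := key b xb hb2
  refine le_of_tendsto_of_tendsto (ka.inner hb2) ((ka.inner ha2).add (kb.inner hb2)) ?_
  filter_upwards [ha1, hb1] with n h1 h2
  have := h.cyc hR hε hG hx h1 h2
  have hn1 : (0 : ℝ) ≤ ((n : ℝ) + 1) * ((n : ℝ) + 1) := by positivity
  simp only [inner_smul_left, inner_smul_right, conj_trivial]
  nlinarith [mul_le_mul_of_nonneg_left this hn1]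

set_option maxHeartbeats 2000000 in
theorem SubG.expand (h : SubG w R Gr) (hR : 0 < R) (hε : 0 < ε)
    (hG : ∀ q ∈ Gr, G (q.1 + ε • q.2) = q.2) (hq : q ∈ Gr)
    (hD : DensAt ((fun q : Ed d × Ed d => q.1 + ε • q.2) '' Gr) (q.1 + ε • q.2))
    (hB : HasFDerivAt G B (q.1 + ε • q.2)) :
    ∀ δ > 0, ∃ ρ > 0, ∀ v, ‖v‖ ≤ ρ →
      w q.1 + ⟪q.2, v⟫ + ⟪((1 / 4 : ℝ) • B) v, v⟫ - δ * ‖v‖ ^ 2 ≤ w (q.1 + v) := by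
  intro δ hδ
  set x := q.1 + ε • q.2 with hx
  set η := min 1 (δ / (‖B‖ + 1)) with hηdef
  have hη : 0 < η := lt_min one_pos (by positivity)
  have hη1 : η ≤ 1 := min_le_left _ _
  have hηB : η * (‖B‖ + 1) ≤ δ := by
    rw [← le_div_iff₀ (by positivity)]; exact min_le_right _ _
  obtain ⟨ρ1, hρ1, h1⟩ := hD η hη
  have h2 := hB.isLittleO.def hη
  rw [Metric.eventually_nhds_iff] at h2
  obtain ⟨ρ2, hρ2, h2⟩ := h2
  refine ⟨min (min ρ1 (ρ2 / 2)) (4 * R), by positivity, fun v hv => ?_⟩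
  have hv1 : ‖v‖ ≤ ρ1 := hv.trans ((min_le_left _ _).trans (min_le_left _ _))
  have hv2 : ‖v‖ ≤ ρ2 / 2 := hv.trans ((min_le_left _ _).trans (min_le_right _ _))
  have hv3 : ‖v‖ ≤ 4 * R := hv.trans (min_le_right _ _)
  have hhalf : ‖(1 / 2 : ℝ) • v‖ = ‖v‖ / 2 := by
    rw [norm_smul]; norm_num; ring
  have hvn := norm_nonneg v
  obtain ⟨x', ⟨q', hq', hx'⟩, h3⟩ := h1 ((1 / 2 : ℝ) • v) (by rw [hhalf]; linarith)
  simp only at hx'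
  set e := x' - (x + (1 / 2 : ℝ) • v) with he
  rw [hhalf] at h3
  have hxx : x' - x = (1 / 2 : ℝ) • v + e := by rw [he]; abel
  have hxn : ‖x' - x‖ ≤ ‖v‖ := by
    rw [hxx]
    refine (norm_add_le _ _).trans ?_
    rw [hhalf]
    nlinarith
  have h4 := h2 (y := x') (by rw [dist_eq_norm]; linarith)
  set P := G x' - G x with hP
  set s := P - B (x' - x) with hs
  have hP1 : G x' = q'.2 := by rw [← hx', hG q' hq']
  have hP2 : G x = q.2 := hG q hq
  have hPq : P = q'.2 - q.2 := by rw [hP, hP1, hP2]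
  have hsn : ‖s‖ ≤ η * ‖v‖ := h4.trans (by gcongr)
  have a1 := (h q' hq').2 (q.1 + v) ((norm_add_le _ _).trans (by linarith [(h q hq).1]))
  have a2 := h.pair hR hq hq'
  have hyy : q'.1 - q.1 = (x' - x) - ε • P := by
    rw [← hx', hx, hPq, smul_sub]; abel
  have b1 : q.1 + v - q'.1 = v - (q'.1 - q.1) := by abel
  have b2 : q'.2 = q.2 + P := by rw [hPq]; abel
  rw [b1, b2, inner_add_left, inner_sub_right] at a1
  -- surplus
  have c1 : ⟪P, v - (q'.1 - q.1)⟫ = ⟪P, (1 / 2 : ℝ) • v - e⟫ + ε * ‖P‖ ^ 2 := by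
    have : v - (q'.1 - q.1) = ((1 / 2 : ℝ) • v - e) + ε • P := by
      rw [hyy, hxx]
      have : v = (1 / 2 : ℝ) • v + (1 / 2 : ℝ) • v := by rw [← add_smul]; norm_num
      nth_rewrite 1 [this]
      abel
    rw [this, inner_add_right, inner_smul_right, real_inner_self_eq_norm_sq]
  have c2 : P = (1 / 2 : ℝ) • B v + (B e + s) := by
    rw [hs, hxx, map_add, map_smul]; abel
  have hen : ‖e‖ ≤ ‖v‖ / 2 := by nlinarith
  have c3 : ‖(1 / 2 : ℝ) • v - e‖ ≤ ‖v‖ := by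
    refine (norm_sub_le _ _).trans ?_
    rw [hhalf]; linarith
  have c4 : ‖B e + s‖ ≤ ‖B‖ * (η * (‖v‖ / 2)) + η * ‖v‖ := by
    refine (norm_add_le _ _).trans (add_le_add ((B.le_opNorm e).trans ?_) hsn)
    gcongr
  have c5 : -((‖B‖ * (η * (‖v‖ / 2)) + η * ‖v‖) * ‖v‖) ≤ ⟪B e + s, (1 / 2 : ℝ) • v - e⟫ := by
    have := abs_le.mp (abs_real_inner_le_norm (B e + s) ((1 / 2 : ℝ) • v - e))
    have h5 : ‖B e + s‖ * ‖(1 / 2 : ℝ) • v - e‖ ≤ (‖B‖ * (η * (‖v‖ / 2)) + η * ‖v‖) * ‖v‖ := by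
      gcongr
    linarith
  have c6 : -(‖B‖ * ‖v‖ * (η * (‖v‖ / 2))) ≤ -⟪B v, e⟫ := by
    have := (abs_le.mp (abs_real_inner_le_norm (B v) e)).2
    have h5 : ‖B v‖ * ‖e‖ ≤ ‖B‖ * ‖v‖ * (η * (‖v‖ / 2)) := by
      gcongr
      exact B.le_opNorm v
    linarith
  have c7 : ⟪P, (1 / 2 : ℝ) • v - e⟫ = 1 / 4 * ⟪B v, v⟫ - 1 / 2 * ⟪B v, e⟫
      + ⟪B e + s, (1 / 2 : ℝ) • v - e⟫ := by
    rw [c2, inner_add_left, inner_smul_left, inner_sub_right, inner_smul_right]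
    simp only [conj_trivial]
    ring
  have c8 : ⟪((1 / 4 : ℝ) • B) v, v⟫ = 1 / 4 * ⟪B v, v⟫ := by
    rw [_root_.smul_apply, inner_smul_left]; simp
  have c9 : 0 ≤ ε * ‖P‖ ^ 2 := by positivity
  have c10 : η * (‖B‖ + 1) * ‖v‖ ^ 2 ≤ δ * ‖v‖ ^ 2 := by gcongr
  have c11 : ⟪P, v - (q'.1 - q.1)⟫ = ⟪P, v⟫ - ⟪P, q'.1 - q.1⟫ := inner_sub_right _ _ _
  have c12 : 0 ≤ ‖B‖ * (η * ‖v‖ ^ 2) := by positivity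
  rw [c8]
  nlinarith

end pointwise

theorem geo_meas {d : ℕ} {w : Ed d → ℝ} {R : ℝ} {Gr : Set (Ed d × Ed d)} (h : SubG w R Gr)
    (hR : 0 < R) {ε : ℝ} (hε : 0 < ε) (hc : IsCompact Gr) {c : ℝ} {F : Ed d → ℝ}
    (hpde : ∀ q ∈ Gr, ∀ T : Ed d →L[ℝ] Ed d, (∀ v, 0 ≤ ⟪T v, v⟫) →
      (∀ δ > 0, ∃ ρ > 0, ∀ v, ‖v‖ ≤ ρ →
        w q.1 + ⟪q.2, v⟫ + ⟪T v, v⟫ - δ * ‖v‖ ^ 2 ≤ w (q.1 + v)) →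
      trOp T ≤ c * (‖q.2‖ + F q.1)) :
    ∃ G : Ed d → Ed d, Continuous G ∧ (∀ q ∈ Gr, G (q.1 + ε • q.2) = q.2) ∧
      ∀ P : Set (Ed d), MeasurableSet P → (∀ p ∈ P, ∃ y, (y, p) ∈ Gr) →
        volume P ≤ ∫⁻ x in ((fun q : Ed d × Ed d => q.1 + ε • q.2) '' Gr) ∩ G ⁻¹' P,
          ENNReal.ofReal (d.factorial * (4 * (c * (‖G x‖ + F (x - ε • G x)))) ^ d) := by
  obtain ⟨C, G, hGL, hG⟩ := h.exists_map hR hε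
  refine ⟨G, hGL.continuous, hG, fun P hP hPG => ?_⟩
  set X := (fun q : Ed d × Ed d => q.1 + ε • q.2) '' Gr with hX
  have hXc : IsCompact X := hc.image (by fun_prop)
  have hXm : MeasurableSet X := hXc.isClosed.measurableSet
  have hAm : MeasurableSet (X ∩ G ⁻¹' P) := hXm.inter (hGL.continuous.measurable hP)
  have hsub : P ⊆ G '' (X ∩ G ⁻¹' P) := by
    intro p hp
    obtain ⟨y, hy⟩ := hPG p hp
    refine ⟨y + ε • p, ⟨⟨(y, p), hy, rfl⟩, ?_⟩, hG _ hy⟩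
    rw [mem_preimage, hG _ hy]; exact hp
  refine (measure_mono hsub).trans ((lip_image_le hGL hAm).trans ?_)
  apply lintegral_mono_ae
  have a1 : ∀ᵐ x ∂(volume.restrict (X ∩ G ⁻¹' P)), DensAt X x :=
    ae_mono (Measure.restrict_mono inter_subset_left le_rfl) (densAt_ae hXm)
  have a2 : ∀ᵐ x ∂(volume.restrict (X ∩ G ⁻¹' P)), DifferentiableAt ℝ G x :=
    ae_restrict_of_ae hGL.ae_differentiableAt
  filter_upwards [a1, a2, ae_restrict_mem hAm] with x hD hdiff hxA
  obtain ⟨q, hq, rfl⟩ := hxA.1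
  set B := fderiv ℝ G (q.1 + ε • q.2) with hB
  have hcy := h.cycB hR hε hG hxA.1 hD hdiff.hasFDerivAt
  have hpos : ∀ a, 0 ≤ ⟪B a, a⟫ := fun a => by simpa using hcy a 0
  have hex := h.expand hR hε hG hq hD hdiff.hasFDerivAt
  have hp := hpde q hq ((1 / 4 : ℝ) • B) (fun v => by
    rw [_root_.smul_apply, inner_smul_left]
    exact mul_nonneg (by norm_num) (hpos v)) hex
  have htr : trOp ((1 / 4 : ℝ) • B) = 1 / 4 * trOp B := by
    simp only [trOp, _root_.smul_apply, inner_smul_left, Finset.mul_sum]; rfl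
  rw [htr] at hp
  have htr0 : 0 ≤ trOp B := Finset.sum_nonneg fun i _ => hpos _
  apply ENNReal.ofReal_le_ofReal
  refine (det_bound hcy).trans ?_
  rw [hG q hq, add_sub_cancel_right]
  gcongr
  linarith

open scoped Pointwise in
theorem annulus_vol {d : ℕ} {s : ℝ} (hs : 0 < s) :
    volume {p : Ed d | s ≤ ‖p‖ ∧ ‖p‖ < 2 * s} =
      ENNReal.ofReal (s ^ d) * volume {p : Ed d | 1 ≤ ‖p‖ ∧ ‖p‖ < 2} := by
  have : {p : Ed d | s ≤ ‖p‖ ∧ ‖p‖ < 2 * s} = s • {p : Ed d | 1 ≤ ‖p‖ ∧ ‖p‖ < 2} := by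
    ext p
    rw [Set.mem_smul_set_iff_inv_smul_mem₀ hs.ne']
    simp only [mem_setOf_eq, norm_smul, norm_inv, Real.norm_of_nonneg hs.le]
    rw [← div_eq_inv_mul, le_div_iff₀ hs, div_lt_iff₀ hs, one_mul]
  rw [this, Measure.addHaar_smul, abs_of_nonneg (by positivity)]
  simp

theorem annulus_pos {d : ℕ} (hd : 1 ≤ d) : 0 < volume {p : Ed d | 1 ≤ ‖p‖ ∧ ‖p‖ < 2} := by
  have hn : (ball ((EuclideanSpace.single (⟨0, hd⟩ : Fin d) (3 / 2 : ℝ)) : Ed d) (1 / 4)) ⊆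
      {p : Ed d | 1 ≤ ‖p‖ ∧ ‖p‖ < 2} := by
    intro p hp
    rw [mem_ball, dist_eq_norm] at hp
    set e : Ed d := EuclideanSpace.single (⟨0, hd⟩ : Fin d) (3 / 2 : ℝ)
    have he : ‖e‖ = 3 / 2 := by simp [e]
    have h1 := norm_sub_norm_le p e
    have h2 := norm_sub_norm_le e p
    rw [norm_sub_rev] at h2
    constructor <;> linarith
  exact (measure_ball_pos _ _ (by norm_num)).trans_le (measure_mono hn)

theorem annulus_ne_top {d : ℕ} : volume {p : Ed d | 1 ≤ ‖p‖ ∧ ‖p‖ < 2} ≠ ⊤ := by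
  refine ((measure_mono (t := ball (0 : Ed d) 2) ?_).trans_lt measure_ball_lt_top).ne
  intro p hp
  simpa using hp.2

theorem add_pow_le_two_mul {a b : ℝ} (ha : 0 ≤ a) (hb : 0 ≤ b) (d : ℕ) :
    (a + b) ^ d ≤ 2 ^ d * (a ^ d + b ^ d) := by
  rcases le_total a b with h | h
  · calc (a + b) ^ d ≤ (2 * b) ^ d := by gcongr; linarith
      _ = 2 ^ d * b ^ d := mul_pow _ _ _
      _ ≤ _ := by gcongr; have := pow_nonneg ha d; linarith
  · calc (a + b) ^ d ≤ (2 * a) ^ d := by gcongr; linarith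
      _ = 2 ^ d * a ^ d := mul_pow _ _ _
      _ ≤ _ := by gcongr; have := pow_nonneg hb d; linarith

/-- dyadic summation of the annulus estimates -/
theorem dyadic_sum {d : ℕ} {w : Ed d → ℝ} {R : ℝ} {Gr : Set (Ed d × Ed d)} (h : SubG w R Gr)
    (hR : 0 < R) {ε : ℝ} (hε : 0 < ε) (hc : IsCompact Gr) {c : ℝ} (hc0 : 0 ≤ c) {F : Ed d → ℝ}
    (hF : ∀ x, 0 ≤ F x)
    (hpde : ∀ q ∈ Gr, ∀ T : Ed d →L[ℝ] Ed d, (∀ v, 0 ≤ ⟪T v, v⟫) →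
      (∀ δ > 0, ∃ ρ > 0, ∀ v, ‖v‖ ≤ ρ →
        w q.1 + ⟪q.2, v⟫ + ⟪T v, v⟫ - δ * ‖v‖ ^ 2 ≤ w (q.1 + v)) →
      trOp T ≤ c * (‖q.2‖ + F q.1)) {μ : ℝ} (hμ : 0 < μ) {N : ℕ}
    (hsurj : ∀ p : Ed d, ‖p‖ < 2 ^ N * μ → ∃ y, (y, p) ∈ Gr) :
    ∃ G : Ed d → Ed d, Continuous G ∧ (∀ q ∈ Gr, G (q.1 + ε • q.2) = q.2) ∧
      N * volume {p : Ed d | 1 ≤ ‖p‖ ∧ ‖p‖ < 2} ≤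
        ENNReal.ofReal (d.factorial * (16 * c) ^ d) *
         ∫⁻ x in ((fun q : Ed d × Ed d => q.1 + ε • q.2) '' Gr),
          (1 + ENNReal.ofReal ((F (x - ε • G x) / μ) ^ d)) := by
  obtain ⟨G, hGc, hG, hm⟩ := geo_meas h hR hε hc hpde
  refine ⟨G, hGc, hG, ?_⟩
  set X := (fun q : Ed d × Ed d => q.1 + ε • q.2) '' Gr with hX
  have hXc : IsCompact X := hc.image (by fun_prop)
  have hXm : MeasurableSet X := hXc.isClosed.measurableSet
  let P : ℕ → Set (Ed d) := fun k => {p : Ed d | 2 ^ k * μ ≤ ‖p‖ ∧ ‖p‖ < 2 * (2 ^ k * μ)}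
  have hPm : ∀ k, MeasurableSet (P k) := fun k =>
    (measurableSet_le measurable_const measurable_norm).inter
      (measurableSet_lt measurable_norm measurable_const)
  set Ω := volume {p : Ed d | 1 ≤ ‖p‖ ∧ ‖p‖ < 2} with hΩ
  set C := ENNReal.ofReal (d.factorial * (16 * c) ^ d) with hC
  have step : ∀ k ∈ Finset.range N, Ω ≤ C * ∫⁻ x in X ∩ G ⁻¹' (P k),
      (1 + ENNReal.ofReal ((F (x - ε • G x) / μ) ^ d)) := by
    intro k hk
    rw [Finset.mem_range] at hk
    set s := 2 ^ k * μ with hs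
    have hs0 : 0 < s := by positivity
    have hsμ : μ ≤ s := by
      have : (1 : ℝ) ≤ 2 ^ k := one_le_pow₀ (by norm_num)
      nlinarith
    have h1 := hm (P k) (hPm k) (fun p hp => hsurj p (hp.2.trans_le (by
      have : (2 : ℝ) ^ (k + 1) ≤ 2 ^ N := pow_le_pow_right₀ (by norm_num) hk
      calc 2 * (2 ^ k * μ) = 2 ^ (k + 1) * μ := by ring
        _ ≤ _ := by gcongr)))
    have h0 : volume (P k) = ENNReal.ofReal (s ^ d) * Ω := annulus_vol hs0
    rw [h0] at h1
    have hAm : MeasurableSet (X ∩ G ⁻¹' (P k)) := hXm.inter (hGc.measurable (hPm k))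
    have h2 : ∫⁻ x in X ∩ G ⁻¹' (P k),
          ENNReal.ofReal (d.factorial * (4 * (c * (‖G x‖ + F (x - ε • G x)))) ^ d) ≤
        ∫⁻ x in X ∩ G ⁻¹' (P k), ENNReal.ofReal (s ^ d) * (C *
          (1 + ENNReal.ofReal ((F (x - ε • G x) / μ) ^ d))) := by
      apply lintegral_mono_ae
      filter_upwards [ae_restrict_mem hAm] with x hx
      have hx2 : ‖G x‖ < 2 * s := hx.2.2
      have hFx := hF (x - ε • G x)
      have e1 : (1 : ℝ≥0∞) + ENNReal.ofReal ((F (x - ε • G x) / μ) ^ d) =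
          ENNReal.ofReal (1 + (F (x - ε • G x) / μ) ^ d) := by
        rw [ENNReal.ofReal_add (by norm_num) (by positivity), ENNReal.ofReal_one]
      rw [e1, hC, ← ENNReal.ofReal_mul (by positivity), ← ENNReal.ofReal_mul (by positivity)]
      apply ENNReal.ofReal_le_ofReal
      have e2 : ‖G x‖ + F (x - ε • G x) ≤ 2 * s * (1 + F (x - ε • G x) / μ) := by
        have : F (x - ε • G x) ≤ s * (F (x - ε • G x) / μ) := by
          rw [← mul_div_assoc, le_div_iff₀ hμ, mul_comm]
          gcongr
        have h0' : 0 ≤ s * (F (x - ε • G x) / μ) := by positivity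
        linarith
      calc (d.factorial : ℝ) * (4 * (c * (‖G x‖ + F (x - ε • G x)))) ^ d
          ≤ d.factorial * (4 * (c * (2 * s * (1 + F (x - ε • G x) / μ)))) ^ d := by gcongr
        _ = d.factorial * ((8 * c) ^ d * s ^ d * (1 + F (x - ε • G x) / μ) ^ d) := by
            rw [← mul_pow, ← mul_pow]; ring_nf
        _ ≤ d.factorial * ((8 * c) ^ d * s ^ d * (2 ^ d * (1 ^ d + (F (x - ε • G x) / μ) ^ d))) := by
            gcongr
            exact add_pow_le_two_mul (by norm_num) (by positivity) d
        _ = s ^ d * (d.factorial * ((8 * c) ^ d * 2 ^ d) * (1 + (F (x - ε • G x) / μ) ^ d)) := by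
            rw [one_pow]; ring
        _ = _ := by rw [← mul_pow]; ring_nf
    have h3 := h1.trans h2
    rw [lintegral_const_mul' _ _ ENNReal.ofReal_ne_top, lintegral_const_mul' _ _ ENNReal.ofReal_ne_top] at h3
    rwa [ENNReal.mul_le_mul_iff_right (by simpa using pow_pos hs0 d) ENNReal.ofReal_ne_top] at h3
  have hdisj : Set.PairwiseDisjoint (↑(Finset.range N)) (fun k => X ∩ G ⁻¹' (P k)) := by
    have hlt : ∀ i j : ℕ, i < j → Disjoint (X ∩ G ⁻¹' (P i)) (X ∩ G ⁻¹' (P j)) := by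
      intro i j hij
      rw [Set.disjoint_left]
      rintro x ⟨_, hx1⟩ ⟨_, hx2⟩
      have h1 : ‖G x‖ < 2 * (2 ^ i * μ) := hx1.2
      have h2 : 2 ^ j * μ ≤ ‖G x‖ := hx2.1
      have h3 : (2 : ℝ) ^ (i + 1) ≤ 2 ^ j := pow_le_pow_right₀ (by norm_num) hij
      have h4 : (2 : ℝ) ^ (i + 1) * μ ≤ 2 ^ j * μ := by gcongr
      rw [pow_succ] at h4
      linarith
    intro i _ j _ hij
    rcases lt_or_gt_of_ne hij with h' | h'
    · exact hlt i j h'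
    · exact (hlt j i h').symm
  have hsum := Finset.sum_le_sum step
  rw [Finset.sum_const, Finset.card_range, nsmul_eq_mul, ← Finset.mul_sum] at hsum
  refine hsum.trans ?_
  gcongr
  rw [← lintegral_biUnion_finset hdisj (fun k _ => hXm.inter (hGc.measurable (hPm k)))]
  apply lintegral_mono_set
  intro x hx
  simp only [mem_iUnion] at hx
  obtain ⟨k, _, hx⟩ := hx
  exact hx.1

/-- pairs (contact point, slope) -/
def contactG {d : ℕ} (w : Ed d → ℝ) (R m : ℝ) : Set (Ed d × Ed d) :=
  {q | ‖q.1‖ ≤ R ∧ ‖q.2‖ ≤ m ∧ ∀ z, ‖z‖ ≤ 5 * R → w q.1 + ⟪q.2, z - q.1⟫ ≤ w z}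

theorem contactG_subG {d : ℕ} (w : Ed d → ℝ) (R m : ℝ) : SubG w R (contactG w R m) :=
  fun _ hq => ⟨hq.1, hq.2.2⟩

theorem contactG_compact {d : ℕ} {w : Ed d → ℝ} (hw : LowerSemicontinuous w) (R m : ℝ) :
    IsCompact (contactG w R m) := by
  have hcl : IsClosed (contactG w R m) := by
    have e : contactG w R m = {q | ‖q.1‖ ≤ R} ∩ ({q | ‖q.2‖ ≤ m} ∩
        ⋂ z : Ed d, ⋂ _ : ‖z‖ ≤ 5 * R, {q : Ed d × Ed d | w q.1 + ⟪q.2, z - q.1⟫ ≤ w z}) := by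
      ext q
      simp only [contactG, mem_inter_iff, mem_iInter]
      rfl
    rw [e]
    refine (isClosed_le (by fun_prop) continuous_const).inter
      ((isClosed_le (by fun_prop) continuous_const).inter
      (isClosed_iInter fun z => isClosed_iInter fun _ => ?_))
    have h1 : LowerSemicontinuous fun q : Ed d × Ed d => w q.1 := hw.comp continuous_fst
    have h2 : Continuous fun q : Ed d × Ed d => (⟪q.2, z - q.1⟫ : ℝ) := by fun_prop
    exact (h1.add h2.lowerSemicontinuous).isClosed_preimage (w z)
  refine (IsCompact.prod (isCompact_closedBall (0 : Ed d) R)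
    (isCompact_closedBall (0 : Ed d) m)).of_isClosed_subset hcl ?_
  intro q hq
  exact ⟨by simpa using hq.1, by simpa using hq.2.1⟩

theorem contactG_low {d : ℕ} {w : Ed d → ℝ} {R m b : ℝ} (hR : 0 < R) (hm : 6 * R * m ≤ 1 / 2)
    (hm0 : 0 < m) {x1 : Ed d} (hx1 : ‖x1‖ ≤ R) (hwx : w x1 ≤ b - 1) {q : Ed d × Ed d}
    (hq : q ∈ contactG w R m) : w q.1 < b := by
  have h1 := hq.2.2 x1 (by linarith)
  have h2 := (abs_le.mp (abs_real_inner_le_norm q.2 (x1 - q.1))).1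
  have h3 : ‖x1 - q.1‖ ≤ 2 * R := (norm_sub_le _ _).trans (by linarith [hq.1])
  have h4 : ‖q.2‖ * ‖x1 - q.1‖ ≤ m * (2 * R) := by
    gcongr
    exact hq.2.1
  nlinarith [mul_pos hR hm0]

theorem contactG_surj {d : ℕ} {w : Ed d → ℝ} (hw : LowerSemicontinuous w) {R m b : ℝ} (hR : 0 < R)
    (hm : 6 * R * m ≤ 1 / 2) (hm0 : 0 < m) (hfar : ∀ x, R ≤ ‖x‖ → b ≤ w x)
    {x1 : Ed d} (hx1 : ‖x1‖ ≤ R) (hwx : w x1 ≤ b - 1) (p : Ed d) (hp : ‖p‖ ≤ m) :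
    ∃ y, (y, p) ∈ contactG w R m := by
  have hlsc : LowerSemicontinuous fun z : Ed d => w z + -⟪p, z⟫ :=
    hw.add (by fun_prop : Continuous fun z : Ed d => -(⟪p, z⟫ : ℝ)).lowerSemicontinuous
  obtain ⟨y, hy, hmin⟩ := (hlsc.lowerSemicontinuousOn (closedBall 0 (5 * R))).exists_isMinOn
    ⟨0, by simp; linarith⟩ (isCompact_closedBall _ _)
  rw [isMinOn_iff] at hmin
  have hmin' : ∀ z, ‖z‖ ≤ 5 * R → w y + ⟪p, z - y⟫ ≤ w z := by
    intro z hz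
    have := hmin z (by simpa using hz)
    rw [inner_sub_right]; linarith
  rw [mem_closedBall, dist_zero_right] at hy
  refine ⟨y, ?_, hp, hmin'⟩
  by_contra hcon
  simp only [not_le] at hcon
  have h0 := hfar y hcon.le
  have h1 := hmin' x1 (by linarith)
  have h2 := (abs_le.mp (abs_real_inner_le_norm p (x1 - y))).1
  have h3 : ‖x1 - y‖ ≤ 6 * R := (norm_sub_le _ _).trans (by linarith)
  have h4 : ‖p‖ * ‖x1 - y‖ ≤ m * (6 * R) := by gcongr
  nlinarith

theorem eps_limit {d : ℕ} {w : Ed d → ℝ} {R m : ℝ} (hw : LowerSemicontinuous w)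
    (hm0 : 0 < m) (hm1 : m ≤ 1) {g : Ed d → ℝ}
    (hg : ContinuousOn g (closedBall 0 (R + 1))) (E : ℝ)
    (hE : ∀ ε : ℝ, 0 < ε → ε ≤ 1 → ∃ G : Ed d → Ed d, Continuous G ∧
      (∀ q ∈ contactG w R m, G (q.1 + ε • q.2) = q.2) ∧
      1 ≤ ENNReal.ofReal E * ∫⁻ x in ((fun q : Ed d × Ed d => q.1 + ε • q.2) '' contactG w R m),
        (ENNReal.ofReal (g (x - ε • G x)) +
          (closedBall (0 : Ed d) (1 / 2)).indicator 1 (x - ε • G x))) :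
    1 ≤ ENNReal.ofReal E * ((∫⁻ x in closedBall (0 : Ed d) (R + 1), ENNReal.ofReal (g x)) +
      volume (Prod.fst '' (contactG w R m) ∩ closedBall (0 : Ed d) (1 / 2))) := by
  set Gr := contactG w R m with hGr
  have hGc : IsCompact Gr := contactG_compact hw R m
  set Tc := Prod.fst '' Gr ∩ closedBall (0 : Ed d) (1 / 2) with hTc
  have hTcc : IsCompact Tc := (hGc.image continuous_fst).inter (isCompact_closedBall _ _)
  set I := ∫⁻ x in closedBall (0 : Ed d) (R + 1), ENNReal.ofReal (g x) with hI
  set V := volume (closedBall (0 : Ed d) (R + 1)) with hV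
  have hVt : V ≠ ⊤ := measure_closedBall_lt_top.ne
  have hUC := (isCompact_closedBall (0 : Ed d) (R + 1)).uniformContinuousOn_of_continuous hg
  rw [Metric.uniformContinuousOn_iff] at hUC
  have key : ∀ η > 0, 1 ≤ ENNReal.ofReal E * (I + ENNReal.ofReal η * V + volume Tc) := by
    intro η hη
    obtain ⟨δ, hδ, hUC⟩ := hUC η hη
    have hlim : Filter.Tendsto (fun ε : ℝ => ENNReal.ofReal E *
        (I + ENNReal.ofReal η * V + volume (cthickening ε Tc))) (nhdsWithin 0 (Ioi 0))
        (nhds (ENNReal.ofReal E * (I + ENNReal.ofReal η * V + volume Tc))) := by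
      refine ENNReal.Tendsto.const_mul ?_ (Or.inr ENNReal.ofReal_ne_top)
      refine tendsto_const_nhds.add ?_
      exact (tendsto_measure_cthickening_of_isCompact hTcc).mono_left nhdsWithin_le_nhds
    refine ge_of_tendsto hlim ?_
    have hev : Ioo (0 : ℝ) (min 1 δ) ∈ nhdsWithin (0 : ℝ) (Ioi 0) :=
      Ioo_mem_nhdsGT (lt_min one_pos hδ)
    filter_upwards [hev] with ε hε
    have hε1 : ε ≤ 1 := hε.2.le.trans (min_le_left _ _)
    have hεδ : ε < δ := hε.2.trans_le (min_le_right _ _)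
    obtain ⟨G, hGcont, hG, h1⟩ := hE ε hε.1 hε1
    refine h1.trans ?_
    gcongr
    set X := (fun q : Ed d × Ed d => q.1 + ε • q.2) '' Gr with hX
    have hXc : IsCompact X := hGc.image (by fun_prop)
    have hXm : MeasurableSet X := hXc.isClosed.measurableSet
    have hnm : ∀ q ∈ Gr, ‖ε • q.2‖ ≤ ε := fun q hq => by
      rw [norm_smul, Real.norm_of_nonneg hε.1.le]
      have := hq.2.1
      have h0 := hε.1
      nlinarith
    have hXsub : X ⊆ closedBall (0 : Ed d) (R + 1) := by
      rintro _ ⟨q, hq, rfl⟩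
      rw [mem_closedBall, dist_zero_right]
      exact (norm_add_le _ _).trans (by linarith [hq.1, hnm q hq])
    have hcont : Continuous fun x => x - ε • G x := by fun_prop
    set S := (fun x => x - ε • G x) ⁻¹' closedBall (0 : Ed d) (1 / 2) with hS
    have hSm : MeasurableSet S := hcont.measurable measurableSet_closedBall
    have hind : ∀ x, (closedBall (0 : Ed d) (1 / 2)).indicator (1 : Ed d → ℝ≥0∞) (x - ε • G x) =
        S.indicator 1 x := by
      intro x
      rw [hS]; rfl
    simp only [hind]
    rw [lintegral_add_right _ (measurable_one.indicator hSm)]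
    refine add_le_add ?_ ?_
    · calc ∫⁻ x in X, ENNReal.ofReal (g (x - ε • G x))
          ≤ ∫⁻ x in X, (ENNReal.ofReal (g x) + ENNReal.ofReal η) := by
            apply lintegral_mono_ae
            filter_upwards [ae_restrict_mem hXm] with x hx
            obtain ⟨q, hq, rfl⟩ := hx
            simp only
            rw [hG q hq, add_sub_cancel_right]
            refine le_trans ?_ (ENNReal.ofReal_add_le)
            apply ENNReal.ofReal_le_ofReal
            have := hUC q.1 (by simpa using hq.1.trans (by linarith)) (q.1 + ε • q.2)
              (hXsub ⟨q, hq, rfl⟩) (by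
                rw [dist_comm, dist_eq_norm, add_sub_cancel_left]
                exact (hnm q hq).trans_lt hεδ)
            rw [Real.dist_eq] at this
            linarith [(abs_lt.mp this).2]
        _ ≤ ∫⁻ x in closedBall (0 : Ed d) (R + 1), (ENNReal.ofReal (g x) + ENNReal.ofReal η) :=
            lintegral_mono_set hXsub
        _ = I + ENNReal.ofReal η * V := by
            rw [lintegral_add_right _ measurable_const, setLIntegral_const]
    · rw [lintegral_indicator_one hSm, Measure.restrict_apply hSm]
      apply measure_mono
      rintro _ ⟨hxS, ⟨q, hq, rfl⟩⟩
      simp only [hS, mem_preimage] at hxS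
      rw [hG q hq, add_sub_cancel_right] at hxS
      refine mem_cthickening_of_dist_le _ q.1 ε _ ⟨⟨q, hq, rfl⟩, hxS⟩ ?_
      rw [dist_eq_norm, add_sub_cancel_left]
      exact hnm q hq
  have hlim2 : Filter.Tendsto (fun η : ℝ => ENNReal.ofReal E *
      (I + ENNReal.ofReal η * V + volume Tc)) (nhdsWithin 0 (Ioi 0))
      (nhds (ENNReal.ofReal E * (I + ENNReal.ofReal 0 * V + volume Tc))) := by
    refine ENNReal.Tendsto.const_mul ?_ (Or.inr ENNReal.ofReal_ne_top)
    refine (tendsto_const_nhds.add ?_).add tendsto_const_nhds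
    refine ENNReal.Tendsto.mul_const ?_ (Or.inr hVt)
    exact (ENNReal.continuous_ofReal.tendsto 0).mono_left nhdsWithin_le_nhds
  have := ge_of_tendsto hlim2 (by filter_upwards [self_mem_nhdsWithin] with η hη using key η hη)
  simpa using this

theorem one_le_sqrt_d {d : ℕ} (hd : 1 ≤ d) : 1 ≤ Real.sqrt d := by
  rw [Real.one_le_sqrt]; exact_mod_cast hd

theorem closedBall_sub_cube {d : ℕ} {a b : ℝ} (hab : a < b) : closedBall (0 : Ed d) a ⊆ cube d b := by
  intro x hx i
  rw [mem_closedBall, dist_zero_right] at hx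
  have := PiLp.norm_apply_le x i
  rw [Real.norm_eq_abs] at this
  simpa using (this.trans hx).trans_lt hab

/-- choice of the barrier constants -/
theorem barrier_consts {d : ℕ} (hd : 1 ≤ d) {lam : ℝ} (hlam : 0 < lam) (A : ℝ) :
    ∃ α M : ℝ, 1 ≤ α ∧ 2 ≤ M ∧ A ≤ α * lam ∧
      2 + M * Real.exp (-α * (4 * Real.sqrt d) ^ 2) ≤ M * Real.exp (-α * (3 * Real.sqrt d) ^ 2) := by
  set α := max 1 (A / lam) with hα
  have hα1 : 1 ≤ α := le_max_left _ _
  set D := Real.exp (-α * (3 * Real.sqrt d) ^ 2) - Real.exp (-α * (4 * Real.sqrt d) ^ 2) with hD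
  have hs := one_le_sqrt_d hd
  have hD0 : 0 < D := by
    rw [hD, sub_pos, Real.exp_lt_exp]
    nlinarith [mul_pos (lt_of_lt_of_le one_pos hα1) (by positivity : 0 < Real.sqrt d ^ 2)]
  refine ⟨α, max 2 (2 / D), hα1, le_max_left _ _, ?_, ?_⟩
  · rw [← div_le_iff₀ hlam]; exact le_max_right _ _
  · have : 2 / D * D ≤ max 2 (2 / D) * D := by
      gcongr; exact le_max_right _ _
    rw [div_mul_cancel₀ _ hD0.ne', hD] at this
    linarith

theorem pde_bound {d : ℕ} {lam Lam C0 : ℝ} (hlam : 0 < lam) (hLam : lam ≤ Lam)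
    (hC0 : 0 ≤ C0) {K : Ed d → ℝ} (hK : KernCond K) {α M R m b : ℝ} (hα : 1 ≤ α) (hM : 2 ≤ M)
    (hR : 1 ≤ R) (hm : 6 * R * m ≤ 1 / 2) (hm0 : 0 < m)
    (hA : 2 * d * Lam + CKer K + 2 * C0 * R ≤ α * lam)
    {r : ℝ} (hr : 0 < r) (hr1 : r ≤ 1) {f u : Ed d → ℝ} {O : Set (Ed d)}
    (hu : SupersolExtremal lam Lam C0 r K f O u) (hO : closedBall 0 R ⊆ O)
    {w : Ed d → ℝ} (hw : ∀ x, w x = u x - M * Real.exp (-α * ‖x‖ ^ 2))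
    (hfar : ∀ x, R ≤ ‖x‖ → b ≤ w x) {x1 : Ed d} (hx1 : ‖x1‖ ≤ R) (hwx : w x1 ≤ b - 1)
    {q : Ed d × Ed d} (hq : q ∈ contactG w R m) {T : Ed d →L[ℝ] Ed d} (hT : ∀ v, 0 ≤ ⟪T v, v⟫)
    (hexp : ∀ δ > 0, ∃ ρ > 0, ∀ v, ‖v‖ ≤ ρ →
        w q.1 + ⟪q.2, v⟫ + ⟪T v, v⟫ - δ * ‖v‖ ^ 2 ≤ w (q.1 + v)) :
    trOp T ≤ ((((4 * R + 2) * CKer K + C0) + 1 + α * M * (2 * d * Lam + CKer K + C0)) / (2 * lam)) *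
      (‖q.2‖ + (|f q.1| + (closedBall (0 : Ed d) (1 / 2)).indicator 1 q.1)) := by
  have hlow := contactG_low (by linarith) hm hm0 hx1 hwx hq
  have hqR := hq.1
  have hCK := CKer_nonneg hK
  have main := contact_ineq hLam hC0 hK hr hr1 hu (by linarith : (0:ℝ) ≤ M) hα hR
    (hO (by simpa using hqR) : q.1 ∈ O) hw (p := q.2)
    (fun v hv => by
      have := hq.2.2 (q.1 + v) ((norm_add_le _ _).trans (by linarith))
      rwa [add_sub_cancel_left] at this)
    (fun v hv => by
      refine hlow.le.trans (hfar _ ?_)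
      have := norm_sub_norm_le v (-q.1)
      rw [norm_neg, sub_neg_eq_add, add_comm v] at this
      linarith) hT hexp
  set e := Real.exp (-α * ‖q.1‖ ^ 2) with he
  have he0 : 0 < e := Real.exp_pos _
  have he1 : e ≤ 1 := Real.exp_le_one_iff.mpr (by nlinarith [sq_nonneg ‖q.1‖])
  set C2 := (4 * R + 2) * CKer K + C0 with hC2
  set C1 := α * M * (2 * d * Lam + CKer K + C0) with hC1
  have hLam0 : 0 < Lam := hlam.trans_le hLam
  have hC20 : 0 ≤ C2 := by positivity
  have hC10 : 0 ≤ C1 := by positivity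
  have hn := norm_nonneg q.1
  have hbr : α * M * e * (-(4 * α * lam * ‖q.1‖ ^ 2) + 2 * d * Lam + CKer K + 2 * C0 * ‖q.1‖) ≤
      C1 * (closedBall (0 : Ed d) (1 / 2)).indicator 1 q.1 := by
    by_cases hin : ‖q.1‖ ≤ 1 / 2
    · rw [indicator_of_mem (by simpa using hin), Pi.one_apply, mul_one]
      have h1 : -(4 * α * lam * ‖q.1‖ ^ 2) + 2 * d * Lam + CKer K + 2 * C0 * ‖q.1‖ ≤
          2 * d * Lam + CKer K + C0 := by
        have : 0 ≤ 4 * α * lam * ‖q.1‖ ^ 2 := by positivity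
        nlinarith
      calc _ ≤ α * M * e * (2 * d * Lam + CKer K + C0) := by gcongr
        _ ≤ α * M * 1 * (2 * d * Lam + CKer K + C0) := by gcongr
        _ = C1 := by rw [hC1]; ring
    · rw [indicator_of_notMem (by simpa using hin), mul_zero]
      push Not at hin
      have h1 : -(4 * α * lam * ‖q.1‖ ^ 2) + 2 * d * Lam + CKer K + 2 * C0 * ‖q.1‖ ≤ 0 := by
        have h2 : 1 / 4 ≤ ‖q.1‖ ^ 2 := by nlinarith
        have h3 : α * lam ≤ 4 * α * lam * ‖q.1‖ ^ 2 := by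
          nlinarith [mul_pos (lt_of_lt_of_le one_pos hα) hlam]
        have h4 : C0 * ‖q.1‖ ≤ C0 * R := by gcongr
        linarith
      have h5 : 0 ≤ α * M * e := by positivity
      nlinarith
  set χ : ℝ := (closedBall (0 : Ed d) (1 / 2)).indicator 1 q.1 with hχ
  have hχ0 : 0 ≤ χ := indicator_nonneg (fun _ _ => by simp) _
  rw [div_mul_eq_mul_div, le_div_iff₀ (by positivity)]
  have hf := neg_abs_le (f q.1)
  have hfa := abs_nonneg (f q.1)
  have hp := norm_nonneg q.2
  have m1 := mul_nonneg hC20 hfa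
  have m2 := mul_nonneg hC20 hχ0
  have m3 := mul_nonneg hC10 hfa
  have m4 := mul_nonneg hC10 hp
  nlinarith

theorem lemmaA {d : ℕ} (hd : 1 ≤ d) {lam Lam C0 : ℝ} (hlam : 0 < lam) (hLam : lam ≤ Lam)
    (hC0 : 0 ≤ C0) {K : Ed d → ℝ} (hK : KernCond K) :
    ∃ M E : ℝ, 2 ≤ M ∧ 0 < E ∧ ∀ r : ℝ, 0 < r → r ≤ 1 → ∀ f : Ed d → ℝ,
      ContinuousOn f (cube d (9 * Real.sqrt d)) →
      ∀ u : Ed d → ℝ, LowerSemicontinuous u → (∀ x, 0 ≤ u x) →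
      SupersolExtremal lam Lam C0 r K f (cube d (9 * Real.sqrt d)) u →
      (∃ x1, ‖x1‖ ≤ 3 * Real.sqrt d ∧ u x1 ≤ 1) →
      1 ≤ ENNReal.ofReal E * ((∫⁻ x in cube d (9 * Real.sqrt d), ENNReal.ofReal (|f x| ^ d)) +
        volume ({x | u x ≤ M} ∩ cube d 1)) := by
  set s := Real.sqrt d with hs
  have hs1 : 1 ≤ s := one_le_sqrt_d hd
  set R := 4 * s with hRdef
  have hR : 1 ≤ R := by linarith
  obtain ⟨α, M, hα, hM, hA, hMe⟩ := barrier_consts hd hlam (2 * d * Lam + CKer K + 2 * C0 * R)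
  have hCK := CKer_nonneg hK
  have hLam0 : 0 < Lam := hlam.trans_le hLam
  set c := ((((4 * R + 2) * CKer K + C0) + 1 + α * M * (2 * d * Lam + CKer K + C0)) / (2 * lam)) with hc
  have hc0 : 0 < c := by positivity
  set m := 1 / (12 * R) with hmdef
  have hm0 : 0 < m := by positivity
  have hm : 6 * R * m ≤ 1 / 2 := by rw [hmdef]; apply le_of_eq; field_simp; norm_num
  have hm1 : m ≤ 1 := by rw [hmdef, div_le_one (by positivity)]; linarith
  set Ω := volume {p : Ed d | 1 ≤ ‖p‖ ∧ ‖p‖ < 2} with hΩ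
  set V := volume (closedBall (0 : Ed d) (R + 1)) with hV
  have hVt : V ≠ ⊤ := measure_closedBall_lt_top.ne
  set D := (d.factorial : ℝ) * (16 * c) ^ d with hD
  have hD0 : 0 < D := by positivity
  obtain ⟨N, hN⟩ := ENNReal.exists_nat_mul_gt (a := Ω) (b := ENNReal.ofReal D * V + 1)
    (annulus_pos hd).ne' (by
      refine ENNReal.add_ne_top.mpr ⟨ENNReal.mul_ne_top ENNReal.ofReal_ne_top hVt, by simp⟩)
  set μ := m / 2 ^ N with hμ
  have hμ0 : 0 < μ := by positivity
  set E := D * (2 / μ) ^ d with hEdef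
  refine ⟨M, E, hM, by positivity, ?_⟩
  intro r hr hr1 f hf u hu hu0 hsup ⟨x1, hx1, hux1⟩
  set w : Ed d → ℝ := fun x => u x - M * Real.exp (-α * ‖x‖ ^ 2) with hw
  set b := -(M * Real.exp (-α * R ^ 2)) with hb
  have hwlsc : LowerSemicontinuous w := by
    have h1 : Continuous fun x : Ed d => -(M * Real.exp (-α * ‖x‖ ^ 2)) := by fun_prop
    have := hu.add h1.lowerSemicontinuous
    simpa only [hw, sub_eq_add_neg] using this
  have hfar : ∀ x, R ≤ ‖x‖ → b ≤ w x := by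
    intro x hx
    have h1 := hu0 x
    have h2 : Real.exp (-α * ‖x‖ ^ 2) ≤ Real.exp (-α * R ^ 2) := by
      rw [Real.exp_le_exp]
      have : R ^ 2 ≤ ‖x‖ ^ 2 := by gcongr
      nlinarith
    have h3 : M * Real.exp (-α * ‖x‖ ^ 2) ≤ M * Real.exp (-α * R ^ 2) := by gcongr
    simp only [hw, hb]; linarith
  have hx1R : ‖x1‖ ≤ R := hx1.trans (by linarith)
  have hwx : w x1 ≤ b - 1 := by
    have h2 : Real.exp (-α * (3 * s) ^ 2) ≤ Real.exp (-α * ‖x1‖ ^ 2) := by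
      rw [Real.exp_le_exp]
      have : ‖x1‖ ^ 2 ≤ (3 * s) ^ 2 := by gcongr
      nlinarith
    have h3 : M * Real.exp (-α * (3 * s) ^ 2) ≤ M * Real.exp (-α * ‖x1‖ ^ 2) := by gcongr
    simp only [hw, hb]; linarith
  have hballs : closedBall (0 : Ed d) (R + 1) ⊆ cube d (9 * s) := closedBall_sub_cube (by linarith)
  have hOR : closedBall (0 : Ed d) R ⊆ cube d (9 * s) := closedBall_sub_cube (by linarith)
  set F : Ed d → ℝ := fun y => |f y| + (closedBall (0 : Ed d) (1 / 2)).indicator 1 y with hF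
  have hχ0 : ∀ y, (0 : ℝ) ≤ (closedBall (0 : Ed d) (1 / 2)).indicator 1 y :=
    fun y => indicator_nonneg (fun _ _ => by simp) _
  have hF0 : ∀ y, 0 ≤ F y := fun y => add_nonneg (abs_nonneg _) (hχ0 y)
  have hlim := eps_limit (R := R) hwlsc hm0 hm1 (g := fun x => |f x| ^ d)
    ((hf.mono hballs).abs.pow d) E (by
    intro ε hε hε1
    obtain ⟨G, hGc, hG, hsum⟩ := dyadic_sum (contactG_subG w R m) (by linarith) hε
      (contactG_compact hwlsc R m) hc0.le hF0
      (fun q hq T hT hexp => pde_bound hlam hLam hC0 hK hα hM hR hm hm0 hA hr hr1 hsup hOR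
        (fun x => rfl) hfar hx1R hwx hq hT hexp) hμ0 (N := N)
      (fun p hp => contactG_surj hwlsc (by linarith) hm hm0 hfar hx1R hwx p (by
        rw [hμ, mul_div_cancel₀ _ (by positivity)] at hp; exact hp.le))
    refine ⟨G, hGc, hG, ?_⟩
    set X := (fun q : Ed d × Ed d => q.1 + ε • q.2) '' contactG w R m with hX
    have hXc : IsCompact X := (contactG_compact hwlsc R m).image (by fun_prop)
    have hXm : MeasurableSet X := hXc.isClosed.measurableSet
    have hXsub : X ⊆ closedBall (0 : Ed d) (R + 1) := by
      rintro _ ⟨q, hq, rfl⟩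
      rw [mem_closedBall, dist_zero_right]
      refine (norm_add_le _ _).trans ?_
      rw [norm_smul, Real.norm_of_nonneg hε.le]
      have h1 := hq.1
      have h2 := hq.2.1
      nlinarith [norm_nonneg q.2]
    rw [lintegral_add_left measurable_const, setLIntegral_const, one_mul, mul_add] at hsum
    have h1 : ENNReal.ofReal D * volume X ≤ ENNReal.ofReal D * V := by
      gcongr
      exact measure_mono hXsub
    have h2 : ENNReal.ofReal D * V + 1 ≤ ENNReal.ofReal D * V + ENNReal.ofReal D *
        ∫⁻ x in X, ENNReal.ofReal ((F (x - ε • G x) / μ) ^ d) :=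
      hN.le.trans (hsum.trans (by gcongr))
    have h3 := (ENNReal.add_le_add_iff_left (ENNReal.mul_ne_top ENNReal.ofReal_ne_top hVt)).mp h2
    refine h3.trans ?_
    rw [hEdef, ENNReal.ofReal_mul hD0.le, mul_assoc]
    gcongr
    rw [← lintegral_const_mul' _ _ ENNReal.ofReal_ne_top]
    apply lintegral_mono
    intro x
    simp only
    set y := x - ε • G x with hy
    have e1 : (closedBall (0 : Ed d) (1 / 2)).indicator (1 : Ed d → ℝ≥0∞) y =
        ENNReal.ofReal (((closedBall (0 : Ed d) (1 / 2)).indicator (1 : Ed d → ℝ) y) ^ d) := by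
      by_cases hin : y ∈ closedBall (0 : Ed d) (1 / 2)
      · rw [indicator_of_mem hin, indicator_of_mem hin]; simp
      · rw [indicator_of_notMem hin, indicator_of_notMem hin, zero_pow (by omega)]; simp
    rw [e1, ← ENNReal.ofReal_add (by positivity) (pow_nonneg (hχ0 y) d),
      ← ENNReal.ofReal_mul (by positivity)]
    apply ENNReal.ofReal_le_ofReal
    rw [div_pow (F y) μ, div_pow 2 μ, div_mul_eq_mul_div]
    gcongr
    exact add_pow_le_two_mul (abs_nonneg _) (hχ0 y) d)
  refine hlim.trans ?_
  suffices hsubs : Prod.fst '' (contactG w R m) ∩ closedBall (0 : Ed d) (1 / 2) ⊆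
      {x | u x ≤ M} ∩ cube d 1 by
    have i1 := lintegral_mono_set (μ := volume) (f := fun x => ENNReal.ofReal (|f x| ^ d)) hballs
    have i2 := measure_mono (μ := volume) hsubs
    gcongr
  rintro _ ⟨⟨q, hq, rfl⟩, hq2⟩
  refine ⟨?_, closedBall_sub_cube (by norm_num) hq2⟩
  have hlow := contactG_low (by linarith) hm hm0 hx1R hwx hq
  have he1 : Real.exp (-α * ‖q.1‖ ^ 2) ≤ 1 :=
    Real.exp_le_one_iff.mpr (by nlinarith [sq_nonneg ‖q.1‖])
  have hbneg : b ≤ 0 := by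
    rw [hb]
    have : 0 ≤ M * Real.exp (-α * R ^ 2) := by positivity
    linarith
  have h5 : M * Real.exp (-α * ‖q.1‖ ^ 2) ≤ M * 1 := by gcongr
  show u q.1 ≤ M
  simp only [hw] at hlow
  linarith

open scoped Pointwise in
theorem pucciMinus_smul {d : ℕ} (lam Lam : ℝ) {t : ℝ} (ht : 0 ≤ t) (X : Matrix (Fin d) (Fin d) ℝ) :
    pucciMinus lam Lam (t • X) = t * pucciMinus lam Lam X := by
  unfold pucciMinus
  have : (fun A => (A * (t • X)).trace) '' ellipticSet lam Lam d =
      t • ((fun A => (A * X).trace) '' ellipticSet lam Lam d) := by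
    rw [← image_smul, image_image]
    refine image_congr fun A _ => ?_
    rw [Matrix.mul_smul, Matrix.trace_smul]
  rw [this, Real.sInf_smul_of_nonneg ht, smul_eq_mul]

section scal
variable {d : ℕ} {φ : Ed d → ℝ} {x0 : Ed d} {ρ m : ℝ}

theorem scal_fderiv (hφ : ContDiff ℝ 2 φ) (x : Ed d) :
    fderiv ℝ (fun x => m * φ (ρ⁻¹ • (x - x0))) x = (m * ρ⁻¹) • fderiv ℝ φ (ρ⁻¹ • (x - x0)) := by
  have h1 : HasFDerivAt (fun x : Ed d => ρ⁻¹ • (x - x0)) (ρ⁻¹ • ContinuousLinearMap.id ℝ (Ed d)) x :=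
    ((hasFDerivAt_id x).sub_const x0).const_smul ρ⁻¹
  have h2 : DifferentiableAt ℝ φ (ρ⁻¹ • (x - x0)) := (hφ.differentiable (by norm_num)) _
  have h3 := (h2.hasFDerivAt.comp x h1).const_mul m
  refine h3.fderiv.trans ?_
  ext v
  simp [mul_assoc]

theorem scal_gradient (hφ : ContDiff ℝ 2 φ) (x : Ed d) :
    gradient (fun x => m * φ (ρ⁻¹ • (x - x0))) x = (m * ρ⁻¹) • gradient φ (ρ⁻¹ • (x - x0)) := by
  rw [gradient, gradient, scal_fderiv hφ]
  simp

theorem scal_hess (hφ : ContDiff ℝ 2 φ) (x : Ed d) :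
    hess (fun x => m * φ (ρ⁻¹ • (x - x0))) x = (m * ρ⁻¹ * ρ⁻¹) • hess φ (ρ⁻¹ • (x - x0)) := by
  have hfd : fderiv ℝ (fun x => m * φ (ρ⁻¹ • (x - x0))) =
      fun x => (m * ρ⁻¹) • fderiv ℝ φ (ρ⁻¹ • (x - x0)) := funext fun x => scal_fderiv hφ x
  have h1 : HasFDerivAt (fun x : Ed d => ρ⁻¹ • (x - x0)) (ρ⁻¹ • ContinuousLinearMap.id ℝ (Ed d)) x :=
    ((hasFDerivAt_id x).sub_const x0).const_smul ρ⁻¹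
  have h2 : DifferentiableAt ℝ (fderiv ℝ φ) (ρ⁻¹ • (x - x0)) :=
    ((hφ.fderiv_right (m := 1) (by norm_num)).differentiable (by norm_num)) _
  have h3 := (h2.hasFDerivAt.comp x h1).const_smul (m * ρ⁻¹)
  ext i j
  simp only [hess, Matrix.of_apply, Matrix.smul_apply, iteratedFDeriv_two_apply, hfd]
  rw [show fderiv ℝ (fun x => (m * ρ⁻¹) • fderiv ℝ φ (ρ⁻¹ • (x - x0))) x = _ from h3.fderiv]
  simp [mul_assoc]

theorem scal_nl (hφ : ContDiff ℝ 2 φ) (hρ : 0 < ρ) (hm : 0 < m) {r : ℝ} (hr : 0 < r) (K : Ed d → ℝ)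
    (y : Ed d) :
    nlMinus K r (fun x => m * φ (ρ⁻¹ • (x - x0))) (x0 + ρ • y) =
      (m * ρ⁻¹ * ρ⁻¹) * nlMinus K (ρ * r) φ y := by
  have hy : ρ⁻¹ • (x0 + ρ • y - x0) = y := by
    rw [add_sub_cancel_left, smul_smul, inv_mul_cancel₀ hρ.ne', one_smul]
  have hδ : ∀ z, deltaOp (fun x => m * φ (ρ⁻¹ • (x - x0))) r (x0 + ρ • y) z =
      m * deltaOp φ (ρ * r) y (ρ⁻¹ • z) := by
    intro z
    have hz : ρ⁻¹ • (x0 + ρ • y + z - x0) = y + ρ⁻¹ • z := by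
      have : x0 + ρ • y + z - x0 = ρ • y + z := by abel
      rw [this, smul_add, smul_smul, inv_mul_cancel₀ hρ.ne', one_smul]
    simp only [deltaOp, scal_gradient hφ, hz, hy]
    by_cases hb : ‖z‖ < 1 / r
    · have hb' : ρ⁻¹ • z ∈ ball (0 : Ed d) (1 / (ρ * r)) := by
        rw [mem_ball, dist_zero_right, norm_smul, Real.norm_of_nonneg (by positivity)]
        rw [lt_div_iff₀ (by positivity)] at hb ⊢
        calc ρ⁻¹ * ‖z‖ * (ρ * r) = (ρ⁻¹ * ρ) * (‖z‖ * r) := by ring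
          _ < 1 := by rw [inv_mul_cancel₀ hρ.ne', one_mul]; exact hb
      rw [indicator_of_mem (by simpa using hb), indicator_of_mem hb', inner_smul_left, inner_smul_right]
      simp only [conj_trivial]
      ring
    · have hb' : ρ⁻¹ • z ∉ ball (0 : Ed d) (1 / (ρ * r)) := by
        rw [mem_ball, dist_zero_right, norm_smul, Real.norm_of_nonneg (by positivity)]
        rw [lt_div_iff₀ (by positivity)] at hb ⊢
        rw [show ρ⁻¹ * ‖z‖ * (ρ * r) = (ρ⁻¹ * ρ) * (‖z‖ * r) by ring, inv_mul_cancel₀ hρ.ne', one_mul]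
        exact hb
      rw [indicator_of_notMem (by simpa using hb), indicator_of_notMem hb']
      ring
  unfold nlMinus
  have e1 : (fun z => max (-deltaOp (fun x => m * φ (ρ⁻¹ • (x - x0))) r (x0 + ρ • y) z) 0 * Kresc K r z) =
      fun z => (fun ζ => (m * r ^ (d + 2)) * (max (-deltaOp φ (ρ * r) y ζ) 0 * K ((ρ * r) • ζ))) (ρ⁻¹ • z) := by
    funext z
    simp only [hδ, Kresc]
    have h1 : max (-(m * deltaOp φ (ρ * r) y (ρ⁻¹ • z))) 0 = m * max (-deltaOp φ (ρ * r) y (ρ⁻¹ • z)) 0 := by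
      rw [mul_max_of_nonneg _ _ hm.le, mul_zero, mul_neg]
    have h2 : (ρ * r) • ρ⁻¹ • z = r • z := by
      rw [smul_smul]; congr 1; field_simp
    rw [h1, h2]; ring
  have e2 : (fun z => max (-deltaOp φ (ρ * r) y z) 0 * Kresc K (ρ * r) z) =
      fun z => (ρ * r) ^ (d + 2) * (max (-deltaOp φ (ρ * r) y z) 0 * K ((ρ * r) • z)) := by
    funext z; simp only [Kresc]; ring
  have e3 := Measure.integral_comp_smul (volume : Measure (Ed d))
    (fun ζ => (m * r ^ (d + 2)) * (max (-deltaOp φ (ρ * r) y ζ) 0 * K ((ρ * r) • ζ))) ρ⁻¹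
  rw [e1, e2, e3, integral_const_mul, integral_const_mul]
  simp only [finrank_euclideanSpace, Fintype.card_fin, smul_eq_mul]
  rw [abs_of_nonneg (by positivity), inv_pow, inv_inv]
  field_simp
  ring

theorem scal_super {lam Lam C0 r : ℝ} {K f u : Ed d → ℝ} {O O' : Set (Ed d)}
    (hu : SupersolExtremal lam Lam C0 r K f O u) (hr : 0 < r) (hρ : 0 < ρ) (hm : 0 < m)
    (hO : ∀ y ∈ O', x0 + ρ • y ∈ O) :
    SupersolExtremal lam Lam C0 (ρ * r) K (fun y => ρ ^ 2 / m * f (x0 + ρ • y)) O'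
      (fun y => u (x0 + ρ • y) / m) := by
  intro φ hφ hb y hy hle heq
  have hy' : ρ⁻¹ • (x0 + ρ • y - x0) = y := by
    rw [add_sub_cancel_left, smul_smul, inv_mul_cancel₀ hρ.ne', one_smul]
  have h := hu (fun x => m * φ (ρ⁻¹ • (x - x0))) ?_ ?_ (x0 + ρ • y) (hO y hy) ?_ ?_
  · rw [scal_hess hφ, scal_gradient hφ, scal_nl hφ hρ hm hr, hy', pucciMinus_smul _ _ (by positivity),
      norm_smul, Real.norm_of_nonneg (by positivity)] at h
    have h2 := mul_le_mul_of_nonneg_left h (by positivity : 0 ≤ ρ ^ 2 / m)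
    refine h2.trans (le_of_eq ?_)
    field_simp
  · exact contDiff_const.mul (hφ.comp ((contDiff_id.sub contDiff_const).const_smul ρ⁻¹))
  · obtain ⟨B, hB⟩ := hb
    refine ⟨m * B, fun x => ?_⟩
    rw [abs_mul, abs_of_pos hm]
    gcongr
    exact hB _
  · intro x
    have := hle (ρ⁻¹ • (x - x0))
    simp only at this
    rw [smul_smul, mul_inv_cancel₀ hρ.ne', one_smul, add_sub_cancel, le_div_iff₀ hm] at this
    linarith
  · simp only [hy']
    simp only at heq
    rw [← heq]; field_simp

theorem scal_lintegral (hρ : 0 < ρ) (x0 : Ed d) (g : Ed d → ℝ≥0∞) {S : Set (Ed d)} (hS : MeasurableSet S) :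
    ∫⁻ y in S, ENNReal.ofReal (ρ ^ d) * g (x0 + ρ • y) = ∫⁻ x in (fun y => x0 + ρ • y) '' S, g x := by
  have hinj : InjOn (fun y : Ed d => x0 + ρ • y) S := by
    intro a _ b _ hab
    exact smul_right_injective (Ed d) hρ.ne' (add_left_cancel hab)
  have hder : ∀ y ∈ S, HasFDerivWithinAt (fun y : Ed d => x0 + ρ • y)
      (ρ • ContinuousLinearMap.id ℝ (Ed d)) S y := fun y _ =>
    (((hasFDerivAt_id y).const_smul ρ).const_add x0).hasFDerivWithinAt
  rw [lintegral_image_eq_lintegral_abs_det_fderiv_mul volume hS hder hinj]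
  have : |(ρ • ContinuousLinearMap.id ℝ (Ed d)).det| = ρ ^ d := by
    have e : (ρ • ContinuousLinearMap.id ℝ (Ed d)).det =
      LinearMap.det (ρ • (LinearMap.id : Ed d →ₗ[ℝ] Ed d)) := rfl
    rw [e, LinearMap.det_smul, LinearMap.det_id, mul_one, abs_of_nonneg (by positivity)]
    simp
  rw [this]

end scal

theorem measurableSet_cubeAt {d : ℕ} (x : Ed d) (δ : ℝ) : MeasurableSet (cubeAt x δ) := by
  have : cubeAt x δ = ⋂ i, {y : Ed d | |y i - x i| < δ} := by
    ext y; simp only [mem_iInter]; rfl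
  rw [this]
  refine MeasurableSet.iInter fun i => ?_
  exact (isOpen_lt (by fun_prop) continuous_const).measurableSet

theorem lemmaA_scaled {d : ℕ} (hd : 1 ≤ d) {lam Lam C0 : ℝ} (hlam : 0 < lam) (hLam : lam ≤ Lam)
    (hC0 : 0 ≤ C0) {K : Ed d → ℝ} (hK : KernCond K) :
    ∃ M E : ℝ, 2 ≤ M ∧ 0 < E ∧ ∀ r : ℝ, 0 < r → r ≤ 1 → ∀ f : Ed d → ℝ,
      ContinuousOn f (cube d (9 * Real.sqrt d)) →
      ENNReal.ofReal E * (∫⁻ x in cube d (9 * Real.sqrt d), ENNReal.ofReal (|f x| ^ d)) ≤ 1 / 2 →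
      ∀ u : Ed d → ℝ, LowerSemicontinuous u → (∀ x, 0 ≤ u x) →
      SupersolExtremal lam Lam C0 r K f (cube d (9 * Real.sqrt d)) u →
      ∀ (c : Ed d) (ρ t : ℝ), 0 < ρ → ρ ≤ 1 → 1 ≤ t →
      cubeAt c (9 * Real.sqrt d * ρ) ⊆ cube d (9 * Real.sqrt d) →
      (∃ x1, ‖x1 - c‖ ≤ 3 * Real.sqrt d * ρ ∧ u x1 ≤ t) →
      ENNReal.ofReal (ρ ^ d) ≤ ENNReal.ofReal (2 * E) * volume ({x | u x ≤ M * t} ∩ cubeAt c ρ) := by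
  obtain ⟨M, E, hM, hE, hmain⟩ := lemmaA hd hlam hLam hC0 hK
  refine ⟨M, E, hM, hE, ?_⟩
  intro r hr hr1 f hf hfE u hu hu0 hsup c ρ t hρ hρ1 ht hcub ⟨x1, hx1, hux1⟩
  set s := Real.sqrt d with hs
  have ht0 : 0 < t := by linarith
  have hmaps : ∀ δ : ℝ, ∀ y, y ∈ cube d δ ↔ c + ρ • y ∈ cubeAt c (δ * ρ) := by
    intro δ y
    simp only [cube, cubeAt, Set.mem_ofPred_eq]
    refine forall_congr' fun i => ?_
    simp only [PiLp.add_apply, PiLp.smul_apply, smul_eq_mul, add_sub_cancel_left, PiLp.zero_apply, sub_zero,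
      abs_mul, abs_of_pos hρ]
    rw [mul_comm, mul_lt_mul_iff_left₀ hρ]
  have hO : ∀ y ∈ cube d (9 * s), c + ρ • y ∈ cube d (9 * s) := fun y hy => hcub ((hmaps _ y).mp hy)
  have haff : Continuous fun y : Ed d => c + ρ • y := by fun_prop
  have hAx := hmain (ρ * r) (by positivity) (by nlinarith)
    (fun y => ρ ^ 2 / t * f (c + ρ • y))
    (continuousOn_const.mul (hf.comp haff.continuousOn hO))
    (fun y => u (c + ρ • y) / t)
    (by
      have h1 : LowerSemicontinuous fun y => u (c + ρ • y) := hu.comp haff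
      intro y a ha
      have ha' : a * t < u (c + ρ • y) := by
        exact (lt_div_iff₀ ht0).mp ha
      filter_upwards [h1 y (a * t) ha'] with z hz
      exact (lt_div_iff₀ ht0).mpr hz)
    (fun y => div_nonneg (hu0 _) ht0.le)
    (scal_super hsup hr hρ ht0 hO)
    ⟨ρ⁻¹ • (x1 - c), by
      rw [norm_smul, Real.norm_of_nonneg (by positivity), inv_mul_le_iff₀ hρ]; linarith, by
      show u (c + ρ • ρ⁻¹ • (x1 - c)) / t ≤ 1
      rw [smul_smul, mul_inv_cancel₀ hρ.ne', one_smul, add_sub_cancel, div_le_one ht0]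
      exact hux1⟩
  -- the integral term
  have hρd : 0 < ρ ^ d := by positivity
  have hintf : (∫⁻ x in cube d (9 * s), ENNReal.ofReal (|ρ ^ 2 / t * f (c + ρ • x)| ^ d)) ≤
      ∫⁻ x in cube d (9 * s), ENNReal.ofReal (|f x| ^ d) := by
    calc (∫⁻ x in cube d (9 * s), ENNReal.ofReal (|ρ ^ 2 / t * f (c + ρ • x)| ^ d))
        ≤ ∫⁻ y in cube d (9 * s), ENNReal.ofReal (ρ ^ d) * ENNReal.ofReal (|f (c + ρ • y)| ^ d) := by
          apply lintegral_mono
          intro y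
          simp only
          rw [← ENNReal.ofReal_mul hρd.le]
          apply ENNReal.ofReal_le_ofReal
          rw [← mul_pow, abs_mul]
          gcongr
          rw [abs_of_nonneg (by positivity), div_le_iff₀ ht0]
          nlinarith
      _ = ∫⁻ x in (fun y => c + ρ • y) '' cube d (9 * s), ENNReal.ofReal (|f x| ^ d) :=
          scal_lintegral hρ c (fun x => ENNReal.ofReal (|f x| ^ d)) (measurableSet_cubeAt _ _)
      _ ≤ _ := lintegral_mono_set (by rintro _ ⟨y, hy, rfl⟩; exact hO y hy)
  have hvol : volume ({x | u (c + ρ • x) / t ≤ M} ∩ cube d 1) =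
      ENNReal.ofReal (ρ ^ d)⁻¹ * volume ({x | u x ≤ M * t} ∩ cubeAt c ρ) := by
    have e : {x | u (c + ρ • x) / t ≤ M} ∩ cube d 1 =
        (fun y : Ed d => ρ • y) ⁻¹' ((fun y => c + y) ⁻¹' ({x | u x ≤ M * t} ∩ cubeAt c ρ)) := by
      ext y
      have := hmaps 1 y
      rw [one_mul] at this
      simp only [mem_inter_iff, mem_preimage, this, Set.mem_ofPred_eq, div_le_iff₀ ht0]
    rw [e, Measure.addHaar_preimage_smul _ hρ.ne', measure_preimage_add]
    simp only [finrank_euclideanSpace, Fintype.card_fin]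
    rw [abs_of_nonneg (by positivity)]
  rw [hvol, mul_add] at hAx
  have h1 : (1 : ℝ≥0∞) ≤ 1 / 2 + ENNReal.ofReal E * (ENNReal.ofReal (ρ ^ d)⁻¹ *
      volume ({x | u x ≤ M * t} ∩ cubeAt c ρ)) := by
    refine hAx.trans ?_
    gcongr
    refine le_trans ?_ hfE
    gcongr
  set W := volume ({x | u x ≤ M * t} ∩ cubeAt c ρ) with hW
  have h2 : (1 : ℝ≥0∞) / 2 ≤ ENNReal.ofReal E * (ENNReal.ofReal (ρ ^ d)⁻¹ * W) := by
    have : (1 : ℝ≥0∞) = 1 / 2 + 1 / 2 := (ENNReal.add_halves 1).symm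
    nth_rewrite 1 [this] at h1
    exact (ENNReal.add_le_add_iff_left (by norm_num)).mp h1
  have h3 : (1 : ℝ≥0∞) ≤ ENNReal.ofReal (2 * E) * (ENNReal.ofReal (ρ ^ d)⁻¹ * W) := by
    have := mul_le_mul_right h2 2
    rw [one_div, ENNReal.mul_inv_cancel (by norm_num) (by norm_num), ← mul_assoc] at this
    rwa [ENNReal.ofReal_mul (by norm_num), ENNReal.ofReal_ofNat]
  calc ENNReal.ofReal (ρ ^ d) = ENNReal.ofReal (ρ ^ d) * 1 := (mul_one _).symm
    _ ≤ ENNReal.ofReal (ρ ^ d) * (ENNReal.ofReal (2 * E) * (ENNReal.ofReal (ρ ^ d)⁻¹ * W)) := by gcongr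
    _ = (ENNReal.ofReal (ρ ^ d) * ENNReal.ofReal (ρ ^ d)⁻¹) * (ENNReal.ofReal (2 * E) * W) := by ring
    _ = _ := by
      rw [← ENNReal.ofReal_mul hρd.le, mul_inv_cancel₀ hρd.ne', ENNReal.ofReal_one, one_mul]

/-- Index of the dyadic cube of generation `n` (subdividing `[-1,1)^d`) containing `y`. -/
def dyI {d : ℕ} (n : ℕ) (y : Ed d) : Fin d → ℤ := fun j => ⌊(y j + 1) / 2 * 2 ^ n⌋

/-- The dyadic cube of generation `n` with given index. -/
def dyF {d : ℕ} (n : ℕ) (κ : Fin d → ℤ) : Set (Ed d) := {y | dyI n y = κ}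

/-- The centre of a dyadic cube. -/
def dyC {d : ℕ} (n : ℕ) (κ : Fin d → ℤ) : Ed d := WithLp.toLp 2 fun j => (2 * (κ j : ℝ) + 1) / 2 ^ n - 1

theorem dyI_succ {d : ℕ} (n : ℕ) (y : Ed d) (j : Fin d) : dyI n y j = dyI (n + 1) y j / 2 := by
  unfold dyI
  have h := Int.floor_div_natCast ((y j + 1) / 2 * 2 ^ (n + 1)) 2
  have e : (y j + 1) / 2 * 2 ^ (n + 1) / ((2 : ℕ) : ℝ) = (y j + 1) / 2 * 2 ^ n := by
    push_cast; rw [pow_succ]; ring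
  rw [e] at h
  rw [h]; rfl

theorem dyI_eq_of_le {d : ℕ} {m n : ℕ} (hmn : m ≤ n) {x y : Ed d} (h : dyI n x = dyI n y) :
    dyI m x = dyI m y := by
  induction n, hmn using Nat.le_induction with
  | base => exact h
  | succ n hn ih =>
    apply ih
    funext j
    rw [dyI_succ, dyI_succ n y, h]

theorem mem_dyF {d : ℕ} (n : ℕ) (κ : Fin d → ℤ) (y : Ed d) :
    y ∈ dyF n κ ↔ ∀ j, (2 : ℝ) * κ j ≤ (y j + 1) * 2 ^ n ∧ (y j + 1) * 2 ^ n < 2 * κ j + 2 := by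
  have : y ∈ dyF n κ ↔ dyI n y = κ := Iff.rfl
  rw [this, funext_iff]
  refine forall_congr' fun j => ?_
  rw [dyI, Int.floor_eq_iff]
  constructor
  · rintro ⟨a, b⟩; constructor <;> linarith
  · rintro ⟨a, b⟩; constructor <;> linarith

theorem mem_dyF' {d : ℕ} (n : ℕ) (κ : Fin d → ℤ) (y : Ed d) :
    y ∈ dyF n κ ↔ ∀ j, -(1 / 2 ^ n : ℝ) ≤ y j - dyC n κ j ∧ y j - dyC n κ j < 1 / 2 ^ n := by
  rw [mem_dyF]
  refine forall_congr' fun j => ?_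
  have hp : (0 : ℝ) < 2 ^ n := by positivity
  have e : y j - dyC n κ j = ((y j + 1) * 2 ^ n - (2 * κ j + 1)) / 2 ^ n := by
    simp only [dyC]; field_simp; ring
  rw [e, ← neg_div, div_le_div_iff_of_pos_right hp, div_lt_div_iff_of_pos_right hp]
  constructor
  · rintro ⟨a, b⟩; constructor <;> linarith
  · rintro ⟨a, b⟩; constructor <;> linarith

theorem measurableSet_dyF {d : ℕ} (n : ℕ) (κ : Fin d → ℤ) : MeasurableSet (dyF (d := d) n κ) := by
  have : dyF n κ = ⋂ j, ({y : Ed d | (2 : ℝ) * κ j ≤ (y j + 1) * 2 ^ n} ∩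
      {y : Ed d | (y j + 1) * 2 ^ n < 2 * κ j + 2}) := by
    ext y; rw [mem_dyF]; simp only [mem_iInter]; rfl
  rw [this]
  refine MeasurableSet.iInter fun i => MeasurableSet.inter ?_ ?_
  · exact (isClosed_le continuous_const (by fun_prop)).measurableSet
  · exact (isOpen_lt (by fun_prop) continuous_const).measurableSet

/-- Calderón–Zygmund type covering lemma on dyadic cubes. -/
theorem dy_cover {d : ℕ} {A B : Set (Ed d)} (hA : MeasurableSet A) (θ : ℝ≥0∞)
    (h : ∀ x ∈ A, ∃ n, dyF n (dyI n x) ⊆ B ∧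
      θ * volume (dyF n (dyI n x)) ≤ volume (dyF n (dyI n x) \ A)) :
    (1 + θ) * volume A ≤ volume B := by
  classical
  set P : ℕ → Ed d → Prop := fun n x => dyF n (dyI n x) ⊆ B ∧
      θ * volume (dyF n (dyI n x)) ≤ volume (dyF n (dyI n x) \ A) with hP
  have hPeq : ∀ m n, m ≤ n → ∀ x y, dyI n x = dyI n y → P m x → P m y := by
    intro m n hmn x y hxy hx
    have := dyI_eq_of_le hmn hxy
    simp only [hP] at hx ⊢
    rwa [← this]
  set F : ℕ × (Fin d → ℤ) → Set (Ed d) := fun q =>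
    {x | dyI q.1 x = q.2 ∧ P q.1 x ∧ ∀ m < q.1, ¬ P m x} with hF
  have hFeq : ∀ q, (F q).Nonempty → F q = dyF q.1 q.2 := by
    rintro q ⟨x, hx1, hx2, hx3⟩
    ext y
    constructor
    · intro hy; exact hy.1
    · intro hy
      have hy' : dyI q.1 y = q.2 := hy
      refine ⟨hy', hPeq _ _ le_rfl x y (hx1.trans hy'.symm) hx2, fun m hm hPm => hx3 m hm ?_⟩
      exact hPeq _ _ hm.le y x (hy'.trans hx1.symm) hPm
  have hFm : ∀ q, MeasurableSet (F q) := by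
    intro q
    rcases (F q).eq_empty_or_nonempty with h0 | h0
    · rw [h0]; exact MeasurableSet.empty
    · rw [hFeq q h0]; exact measurableSet_dyF _ _
  have hFθ : ∀ q, θ * volume (F q) ≤ volume (F q \ A) := by
    intro q
    rcases (F q).eq_empty_or_nonempty with h0 | h0
    · rw [h0]; simp
    · have h1 := hFeq q h0
      obtain ⟨x, hx1, hx2, hx3⟩ := h0
      rw [h1, ← hx1]
      exact hx2.2
  have hdis : Pairwise (Function.onFun Disjoint F) := by
    intro q q' hne
    refine Set.disjoint_left.mpr fun x hx hx' => hne ?_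
    have hn : q.1 = q'.1 := by
      rcases lt_trichotomy q.1 q'.1 with hlt | heq | hgt
      · exact absurd hx.2.1 (hx'.2.2 _ hlt)
      · exact heq
      · exact absurd hx'.2.1 (hx.2.2 _ hgt)
    refine Prod.ext hn ?_
    rw [← hx.1, ← hx'.1, hn]
  have hdis' : Pairwise (Function.onFun Disjoint fun q => F q \ A) := fun q q' hne =>
    (hdis hne).mono sdiff_subset sdiff_subset
  have hAE : A ⊆ ⋃ q, F q := by
    intro x hx
    have hex := h x hx
    refine mem_iUnion.mpr ⟨(Nat.find hex, dyI (Nat.find hex) x), rfl, Nat.find_spec hex, fun m hm => ?_⟩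
    exact Nat.find_min hex hm
  have hEB : (⋃ q, F q) ⊆ B := by
    intro x hx
    obtain ⟨q, hq⟩ := mem_iUnion.mp hx
    exact hq.2.1.1 rfl
  have hθE : θ * volume (⋃ q, F q) ≤ volume ((⋃ q, F q) \ A) := by
    rw [iUnion_sdiff, measure_iUnion hdis hFm, measure_iUnion hdis' (fun q => (hFm q).diff hA),
      ← ENNReal.tsum_mul_left]
    exact ENNReal.tsum_le_tsum hFθ
  calc (1 + θ) * volume A = volume A + θ * volume A := by ring
    _ ≤ volume A + θ * volume (⋃ q, F q) := by gcongr
    _ ≤ volume ((⋃ q, F q) ∩ A) + volume ((⋃ q, F q) \ A) := by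
      rw [inter_eq_self_of_subset_right hAE]; gcongr
    _ = volume (⋃ q, F q) := measure_inter_add_sdiff _ hA
    _ ≤ volume B := measure_mono hEB

theorem norm_le_of_coord {d : ℕ} {x : Ed d} {a : ℝ} (ha : 0 ≤ a) (h : ∀ j, |x j| ≤ a) :
    ‖x‖ ≤ Real.sqrt d * a := by
  rw [EuclideanSpace.norm_eq]
  apply Real.sqrt_le_iff.mpr
  refine ⟨by positivity, ?_⟩
  rw [mul_pow, Real.sq_sqrt (by positivity)]
  calc ∑ i, ‖x i‖ ^ 2 ≤ ∑ _i : Fin d, a ^ 2 := by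
        apply Finset.sum_le_sum
        intro i _
        have := h i
        rw [Real.norm_eq_abs]
        gcongr
    _ = d * a ^ 2 := by simp

theorem dyF_volume_le {d : ℕ} (n : ℕ) (κ : Fin d → ℤ) :
    volume (dyF (d := d) n κ) ≤ ENNReal.ofReal ((1 / 2 ^ n) ^ d) * volume (closedBall (0 : Ed d) (Real.sqrt d)) := by
  have hsub : dyF (d := d) n κ ⊆ closedBall (dyC n κ) ((1 / 2 ^ n) * Real.sqrt d) := by
    intro y hy
    rw [mem_dyF'] at hy
    rw [mem_closedBall, dist_eq_norm, mul_comm]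
    apply norm_le_of_coord (by positivity)
    intro j
    rw [PiLp.sub_apply, abs_le]
    exact ⟨(hy j).1, (hy j).2.le⟩
  refine (measure_mono hsub).trans ?_
  rw [Measure.addHaar_closedBall_mul _ _ (by positivity) (by positivity)]
  simp

theorem cubeAt_sub_dyF {d : ℕ} (n : ℕ) (κ : Fin d → ℤ) : cubeAt (dyC n κ) (1 / 2 ^ n) ⊆ dyF (d := d) n κ := by
  intro y hy
  rw [mem_dyF']
  intro j
  have := abs_lt.mp (hy j)
  exact ⟨this.1.le, this.2⟩

theorem ball_sub_cubeAt {d : ℕ} (c : Ed d) (ρ : ℝ) : ball c ρ ⊆ cubeAt c ρ := by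
  intro y hy j
  rw [mem_ball, dist_eq_norm] at hy
  have := PiLp.norm_apply_le (y - c) j
  rw [PiLp.sub_apply, Real.norm_eq_abs] at this
  linarith

theorem dyC_bound {d : ℕ} {n : ℕ} {x : Ed d} (hx : dyI 0 x = 0) (j : Fin d) :
    |dyC n (dyI n x) j| ≤ 1 - 1 / 2 ^ n := by
  have h0 : x ∈ dyF 0 (0 : Fin d → ℤ) := hx
  rw [mem_dyF] at h0
  have h1 := h0 j
  simp only [Pi.zero_apply, Int.cast_zero, mul_zero, pow_zero, mul_one, zero_add] at h1
  have hp : (0 : ℝ) < 2 ^ n := by positivity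
  have a1 : (0 : ℤ) ≤ dyI n x j := by
    apply Int.floor_nonneg.mpr
    have : 0 ≤ (x j + 1) / 2 := by linarith
    positivity
  have a2 : dyI n x j < 2 ^ n := by
    rw [dyI, Int.floor_lt]
    push_cast
    have : (x j + 1) / 2 < 1 := by linarith
    nlinarith
  have a2' : dyI n x j + 1 ≤ 2 ^ n := a2
  have b1 : (0 : ℝ) ≤ dyI n x j := by exact_mod_cast a1
  have b2 : (dyI n x j : ℝ) + 1 ≤ 2 ^ n := by exact_mod_cast a2'
  have e : dyC n (dyI n x) j = (2 * (dyI n x j : ℝ) + 1) / 2 ^ n - 1 := rfl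
  rw [e, abs_le]
  have e1 : (2 * (dyI n x j : ℝ) + 1) / 2 ^ n = 2 * ((dyI n x j : ℝ) / 2 ^ n) + 1 / 2 ^ n := by ring
  have e2 : 0 ≤ (dyI n x j : ℝ) / 2 ^ n := by positivity
  have e3 : (dyI n x j : ℝ) / 2 ^ n + 1 / 2 ^ n ≤ 1 := by
    rw [← add_div, div_le_one hp]; exact b2
  rw [e1]
  constructor <;> linarith

theorem dy_cube_sub {d : ℕ} (hd : 1 ≤ d) {n : ℕ} {x : Ed d} (hx : dyI 0 x = 0) :
    cubeAt (dyC n (dyI n x)) (9 * Real.sqrt d * (1 / 2 ^ n)) ⊆ cube d (9 * Real.sqrt d) := by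
  intro y hy j
  have h1 := hy j
  have h2 := dyC_bound (n := n) hx j
  have h3 := one_le_sqrt_d hd
  have h4 : (1 : ℝ) / 2 ^ n ≤ 1 := by
    rw [div_le_one (by positivity)]; exact one_le_pow₀ (by norm_num)
  have h5 : |y j| ≤ |y j - dyC n (dyI n x) j| + |dyC n (dyI n x) j| := by
    have := abs_add_le (y j - dyC n (dyI n x) j) (dyC n (dyI n x) j)
    rwa [sub_add_cancel] at this
  rw [PiLp.zero_apply, sub_zero]
  nlinarith

theorem dy_parent {d : ℕ} {n : ℕ} {x y : Ed d} (hy : y ∈ dyF n (dyI n x)) :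
    ‖y - dyC (n + 1) (dyI (n + 1) x)‖ ≤ 3 * Real.sqrt d * (1 / 2 ^ (n + 1)) := by
  have hmain := norm_le_of_coord (x := y - dyC (n + 1) (dyI (n + 1) x)) (a := 3 * (1 / 2 ^ (n + 1)))
    (by positivity) ?_
  · linarith
  intro j
  rw [mem_dyF] at hy
  have h1 := hy j
  have h2 := dyI_succ n x j
  have hp : (0 : ℝ) < 2 ^ (n + 1) := by positivity
  have c1 : 2 * dyI n x j ≤ dyI (n + 1) x j := by omega
  have c2 : dyI (n + 1) x j ≤ 2 * dyI n x j + 1 := by omega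
  have c1' : 2 * (dyI n x j : ℝ) ≤ dyI (n + 1) x j := by exact_mod_cast c1
  have c2' : (dyI (n + 1) x j : ℝ) ≤ 2 * dyI n x j + 1 := by exact_mod_cast c2
  have e : (y - dyC (n + 1) (dyI (n + 1) x)) j =
      ((y j + 1) * 2 ^ (n + 1) - (2 * (dyI (n + 1) x j : ℝ) + 1)) / 2 ^ (n + 1) := by
    rw [PiLp.sub_apply]; simp only [dyC]; field_simp; ring
  rw [e, abs_div, abs_of_pos hp, ← mul_div_assoc, mul_one, div_le_div_iff_of_pos_right hp, abs_le]
  have e2 : (y j + 1) * 2 ^ (n + 1) = 2 * ((y j + 1) * 2 ^ n) := by rw [pow_succ]; ring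
  rw [e2]
  constructor <;> linarith

theorem cube_one_sub_dyF {d : ℕ} : cube d 1 ⊆ dyF (d := d) 0 0 := by
  have h := cubeAt_sub_dyF (d := d) 0 0
  have e : dyC (d := d) 0 0 = 0 := by
    ext j; simp [dyC]
  rw [e] at h
  simpa [cube] using h

theorem dyF_sub_dyF {d : ℕ} {m n : ℕ} (hmn : m ≤ n) (x : Ed d) : dyF n (dyI n x) ⊆ dyF m (dyI m x) := by
  intro y hy
  exact dyI_eq_of_le hmn hy

theorem dy_exists_sub {d : ℕ} {x : Ed d} {O : Set (Ed d)} (hO : IsOpen O) (hx : x ∈ O) :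
    ∃ n, dyF n (dyI n x) ⊆ O := by
  obtain ⟨ε, hε, hball⟩ := Metric.isOpen_iff.mp hO x hx
  obtain ⟨n, hn⟩ := exists_pow_lt_of_lt_one (show 0 < ε / (2 * Real.sqrt d + 1) by positivity)
    (show (1 / 2 : ℝ) < 1 by norm_num)
  refine ⟨n, fun y hy => hball ?_⟩
  have hx' : x ∈ dyF n (dyI n x) := rfl
  rw [mem_dyF'] at hy hx'
  rw [mem_ball, dist_eq_norm]
  have h := norm_le_of_coord (x := y - x) (a := 2 * (1 / 2 ^ n)) (by positivity) (by
    intro j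
    rw [PiLp.sub_apply, abs_le]
    have h1 := hy j
    have h2 := hx' j
    constructor <;> linarith)
  rw [div_pow, one_pow, lt_div_iff₀ (by positivity)] at hn
  have : (0 : ℝ) < 1 / 2 ^ n := by positivity
  nlinarith

theorem decay {d : ℕ} (hd : 1 ≤ d) {lam Lam C0 : ℝ} (hlam : 0 < lam) (hLam : lam ≤ Lam)
    (hC0 : 0 ≤ C0) {K : Ed d → ℝ} (hK : KernCond K) :
    ∃ (M E : ℝ) (θ : ℝ≥0∞), 2 ≤ M ∧ 0 < E ∧ θ ≠ 0 ∧ θ ≠ ∞ ∧ ∀ r : ℝ, 0 < r → r ≤ 1 → ∀ f : Ed d → ℝ,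
      ContinuousOn f (cube d (9 * Real.sqrt d)) →
      ENNReal.ofReal E * (∫⁻ x in cube d (9 * Real.sqrt d), ENNReal.ofReal (|f x| ^ d)) ≤ 1 / 2 →
      ∀ u : Ed d → ℝ, LowerSemicontinuous u → (∀ x, 0 ≤ u x) →
      SupersolExtremal lam Lam C0 r K f (cube d (9 * Real.sqrt d)) u →
      (∃ x1 ∈ cube d 1, u x1 ≤ 1) →
      ∀ k : ℕ, (1 + θ) ^ k * volume ({x | M ^ k < u x} ∩ dyF 0 0) ≤ volume (dyF (d := d) 0 0) := by
  obtain ⟨M, E, hM, hE, hmain⟩ := lemmaA_scaled hd hlam hLam hC0 hK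
  set V := volume (closedBall (0 : Ed d) (Real.sqrt d)) with hV
  have hs1 := one_le_sqrt_d hd
  have hV0 : V ≠ 0 := (measure_closedBall_pos volume (0 : Ed d) (by linarith)).ne'
  have hVt : V ≠ ∞ := measure_closedBall_lt_top.ne
  have hE2 : ENNReal.ofReal (2 * E) ≠ 0 := by
    rw [Ne, ENNReal.ofReal_eq_zero, not_le]; linarith
  have hVE0 : V * ENNReal.ofReal (2 * E) ≠ 0 := mul_ne_zero hV0 hE2
  have hVEt : V * ENNReal.ofReal (2 * E) ≠ ∞ := ENNReal.mul_ne_top hVt ENNReal.ofReal_ne_top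
  refine ⟨M, E, (V * ENNReal.ofReal (2 * E))⁻¹, hM, hE, ENNReal.inv_ne_zero.mpr hVEt,
    ENNReal.inv_ne_top.mpr hVE0, ?_⟩
  intro r hr hr1 f hf hfE u hu hu0 hsup ⟨x1, hx1, hux1⟩ k
  have hA := hmain r hr hr1 f hf hfE u hu hu0 hsup
  set θ := (V * ENNReal.ofReal (2 * E))⁻¹ with hθ
  have hθ0 : θ ≠ 0 := ENNReal.inv_ne_zero.mpr hVEt
  have hMk : ∀ k : ℕ, 1 ≤ M ^ k := fun k => one_le_pow₀ (by linarith)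
  have hopen : ∀ a : ℝ, IsOpen {x | a < u x} := fun a => hu.isOpen_preimage a
  -- a cube with a small value nearby is good
  have hgood : ∀ (k n : ℕ) (x : Ed d), dyI 0 x = 0 →
      (∃ y, ‖y - dyC n (dyI n x)‖ ≤ 3 * Real.sqrt d * (1 / 2 ^ n) ∧ u y ≤ M ^ k) →
      θ * volume (dyF n (dyI n x)) ≤
        volume (dyF n (dyI n x) \ ({x | M ^ (k + 1) < u x} ∩ dyF 0 0)) := by
    intro k n x hx hy
    have h := hA (dyC n (dyI n x)) (1 / 2 ^ n) (M ^ k) (by positivity)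
      (by rw [div_le_one (by positivity)]; exact one_le_pow₀ (by norm_num)) (hMk k)
      (dy_cube_sub hd hx) hy
    have hsub : {z | u z ≤ M * M ^ k} ∩ cubeAt (dyC n (dyI n x)) (1 / 2 ^ n) ⊆
        dyF n (dyI n x) \ ({x | M ^ (k + 1) < u x} ∩ dyF 0 0) := by
      rintro z ⟨hz1, hz2⟩
      refine ⟨cubeAt_sub_dyF _ _ hz2, fun hz3 => ?_⟩
      have a1 : u z ≤ M * M ^ k := hz1
      have a2 : M ^ (k + 1) < u z := hz3.1
      rw [pow_succ] at a2
      linarith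
    rw [hθ, ENNReal.inv_mul_le_iff hVE0 hVEt]
    calc volume (dyF n (dyI n x)) ≤ ENNReal.ofReal ((1 / 2 ^ n) ^ d) * V := dyF_volume_le _ _
      _ ≤ (ENNReal.ofReal (2 * E) * volume (dyF n (dyI n x) \ ({x | M ^ (k + 1) < u x} ∩ dyF 0 0))) * V := by
        gcongr
        refine h.trans ?_
        gcongr
      _ = _ := by ring
  have hstep : ∀ k : ℕ, (1 + θ) * volume ({x | M ^ (k + 1) < u x} ∩ dyF 0 0) ≤
      volume ({x | M ^ k < u x} ∩ dyF (d := d) 0 0) := by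
    intro k
    apply dy_cover ((hopen _).measurableSet.inter (measurableSet_dyF _ _))
    rintro x ⟨hxu, hx0⟩
    have hx0' : dyI 0 x = 0 := hx0
    set A := {x | M ^ (k + 1) < u x} ∩ dyF (d := d) 0 0 with hAdef
    classical
    have hex : ∃ n, ¬ (θ * volume (dyF n (dyI n x)) ≤ volume (dyF n (dyI n x) \ A)) := by
      obtain ⟨n, hn⟩ := dy_exists_sub (hopen (M ^ (k + 1))) hxu
      refine ⟨n, ?_⟩
      have hsub : dyF n (dyI n x) ⊆ A := by
        refine subset_inter hn ?_
        have := dyF_sub_dyF (Nat.zero_le n) x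
        rwa [hx0'] at this
      rw [Set.sdiff_eq_empty.mpr hsub, measure_empty, not_le]
      apply ENNReal.mul_pos hθ0
      refine (lt_of_lt_of_le ?_ (measure_mono ((ball_sub_cubeAt _ _).trans (cubeAt_sub_dyF _ _)))).ne'
      exact measure_ball_pos _ _ (by positivity)
    have h0 : θ * volume (dyF 0 (dyI 0 x)) ≤ volume (dyF 0 (dyI 0 x) \ A) := by
      apply hgood k 0 x hx0'
      refine ⟨x1, ?_, hux1.trans (hMk k)⟩
      have e : dyC (d := d) 0 0 = 0 := by
        ext j; simp [dyC]
      rw [hx0', e, sub_zero]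
      have := norm_le_of_coord (x := x1) (a := 1) (by norm_num) (fun j => by
        have := hx1 j
        rw [PiLp.zero_apply, sub_zero] at this
        exact this.le)
      norm_num
      linarith
    have hfind := Nat.find_spec hex
    have hmin := fun m => Nat.find_min hex (m := m)
    obtain ⟨n, hn⟩ : ∃ n, Nat.find hex = n + 1 := by
      refine Nat.exists_eq_succ_of_ne_zero fun h => ?_
      rw [h] at hfind
      exact hfind h0
    rw [hn] at hfind
    have hgn := not_not.mp (hmin n (by omega))
    refine ⟨n, ?_, hgn⟩
    intro y hy
    constructor
    · by_contra hcon
      have hcon' : u y ≤ M ^ k := not_lt.mp hcon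
      exact hfind (hgood k (n + 1) x hx0' ⟨y, dy_parent hy, hcon'⟩)
    · have := dyF_sub_dyF (Nat.zero_le n) x hy
      rwa [hx0'] at this
  induction k with
  | zero =>
    rw [pow_zero, one_mul]
    exact measure_mono inter_subset_right
  | succ k ih =>
    refine le_trans ?_ ih
    rw [pow_succ, mul_assoc]
    gcongr
    exact hstep k

theorem layer_bound {d : ℕ} {M ε s : ℝ} (hM : 2 ≤ M) (hε : 0 < ε) (hs : M ^ ε = s) {θ : ℝ≥0∞}
    {v : Ed d → ℝ} (hv : Measurable v) (hv0 : ∀ x, 0 ≤ v x)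
    (hdec : ∀ k : ℕ, (1 + θ) ^ k * volume ({x | M ^ k < v x} ∩ dyF 0 0) ≤ volume (dyF (d := d) 0 0))
    (hθ : θ ≠ ∞) :
    ∫⁻ x in cube d 1, ENNReal.ofReal (v x ^ ε) ≤
      volume (dyF (d := d) 0 0) * (1 + ∑' k : ℕ, ENNReal.ofReal s ^ (k + 1) * ((1 + θ)⁻¹) ^ k) := by
  have hs0 : 0 < s := by rw [← hs]; positivity
  have hmeas : ∀ k : ℕ, MeasurableSet {x | M ^ k < v x} := fun k => measurableSet_lt measurable_const hv
  have hpt : ∀ x, ENNReal.ofReal (v x ^ ε) ≤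
      1 + ∑' k : ℕ, {x | M ^ k < v x}.indicator (fun _ => ENNReal.ofReal s ^ (k + 1)) x := by
    intro x
    by_cases h1 : v x ≤ 1
    · refine le_trans ?_ le_self_add
      rw [← ENNReal.ofReal_one]
      exact ENNReal.ofReal_le_ofReal (Real.rpow_le_one (hv0 x) h1 hε.le)
    · push Not at h1
      classical
      have hex : ∃ m : ℕ, v x ≤ M ^ m := by
        obtain ⟨m, hm⟩ := pow_unbounded_of_one_lt (v x) (by linarith : 1 < M)
        exact ⟨m, hm.le⟩
      obtain ⟨k, hk⟩ : ∃ k, Nat.find hex = k + 1 := by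
        refine Nat.exists_eq_succ_of_ne_zero fun h => ?_
        have := Nat.find_spec hex
        rw [h, pow_zero] at this
        linarith
      have hle : v x ≤ M ^ (k + 1) := by rw [← hk]; exact Nat.find_spec hex
      have hlt : M ^ k < v x := not_le.mp (Nat.find_min hex (m := k) (by omega))
      refine le_trans ?_ (le_trans (ENNReal.le_tsum k) le_add_self)
      rw [indicator_of_mem (show x ∈ {x | M ^ k < v x} from hlt), ← ENNReal.ofReal_pow hs0.le]
      apply ENNReal.ofReal_le_ofReal
      calc v x ^ ε ≤ (M ^ (k + 1)) ^ ε := Real.rpow_le_rpow (hv0 x) hle hε.le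
        _ = (M ^ ε) ^ (k + 1) := by
          rw [← Real.rpow_natCast, ← Real.rpow_natCast, ← Real.rpow_mul (by linarith),
            ← Real.rpow_mul (by linarith), mul_comm]
        _ = s ^ (k + 1) := by rw [hs]
  have hfin : ∀ k : ℕ, (1 + θ) ^ k ≠ 0 := fun k => pow_ne_zero _ (by simp)
  have hfin' : ∀ k : ℕ, (1 + θ) ^ k ≠ ∞ := fun k => ENNReal.pow_ne_top (by simp [hθ])
  calc ∫⁻ x in cube d 1, ENNReal.ofReal (v x ^ ε)
      ≤ ∫⁻ x in dyF 0 0, ENNReal.ofReal (v x ^ ε) := lintegral_mono_set cube_one_sub_dyF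
    _ ≤ ∫⁻ x in dyF 0 0, (1 + ∑' k : ℕ, {x | M ^ k < v x}.indicator (fun _ => ENNReal.ofReal s ^ (k + 1)) x) :=
        lintegral_mono hpt
    _ = volume (dyF (d := d) 0 0) + ∑' k : ℕ, ENNReal.ofReal s ^ (k + 1) * volume ({x | M ^ k < v x} ∩ dyF 0 0) := by
        rw [lintegral_add_left measurable_const, lintegral_one, Measure.restrict_apply_univ,
          lintegral_tsum (fun k => (measurable_const.indicator (hmeas k)).aemeasurable)]
        congr 1
        refine tsum_congr fun k => ?_
        rw [lintegral_indicator_const (hmeas k), Measure.restrict_apply (hmeas k)]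
    _ ≤ volume (dyF (d := d) 0 0) + ∑' k : ℕ, volume (dyF (d := d) 0 0) * (ENNReal.ofReal s ^ (k + 1) * ((1 + θ)⁻¹) ^ k) := by
        refine add_le_add le_rfl (ENNReal.tsum_le_tsum fun k => ?_)
        have : volume ({x | M ^ k < v x} ∩ dyF 0 0) ≤ ((1 + θ) ^ k)⁻¹ * volume (dyF (d := d) 0 0) := by
          rw [mul_comm, ← div_eq_mul_inv, ENNReal.le_div_iff_mul_le (Or.inl (hfin k)) (Or.inl (hfin' k)), mul_comm]
          exact hdec k
        calc _ ≤ ENNReal.ofReal s ^ (k + 1) * (((1 + θ) ^ k)⁻¹ * volume (dyF (d := d) 0 0)) := by gcongr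
          _ = _ := by rw [ENNReal.inv_pow]; ring
    _ = _ := by rw [ENNReal.tsum_mul_left]; ring

theorem layer_const {d : ℕ} {s : ℝ} (hs : 1 < s) {θ : ℝ≥0∞} (hθ : 1 + θ = ENNReal.ofReal (s ^ 2)) :
    volume (dyF (d := d) 0 0) * (1 + ∑' k : ℕ, ENNReal.ofReal s ^ (k + 1) * ((1 + θ)⁻¹) ^ k) ≠ ∞ := by
  have hs0 : 0 < s := by linarith
  apply ENNReal.mul_ne_top
  · refine ne_top_of_le_ne_top ?_ (dyF_volume_le 0 0)
    exact ENNReal.mul_ne_top ENNReal.ofReal_ne_top measure_closedBall_lt_top.ne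
  apply ENNReal.add_ne_top.mpr ⟨ENNReal.one_ne_top, ?_⟩
  have e : ∀ k : ℕ, ENNReal.ofReal s ^ (k + 1) * ((1 + θ)⁻¹) ^ k =
      ENNReal.ofReal s * (ENNReal.ofReal s⁻¹) ^ k := by
    intro k
    rw [hθ, ← ENNReal.ofReal_inv_of_pos (by positivity), ← ENNReal.ofReal_pow hs0.le,
      ← ENNReal.ofReal_pow (by positivity), ← ENNReal.ofReal_pow (by positivity),
      ← ENNReal.ofReal_mul (by positivity), ← ENNReal.ofReal_mul (by positivity)]
    congr 1
    rw [inv_pow, inv_pow, ← pow_mul]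
    field_simp
    ring
  simp_rw [e]
  rw [ENNReal.tsum_mul_left, ENNReal.tsum_geometric]
  apply ENNReal.mul_ne_top ENNReal.ofReal_ne_top
  apply ENNReal.inv_ne_top.mpr
  rw [Ne, tsub_eq_zero_iff_le, not_le, ← ENNReal.ofReal_one, ENNReal.ofReal_lt_ofReal_iff (by norm_num)]
  exact inv_lt_one_of_one_lt₀ hs

/-- the weak Harnack inequality (Theorem 3.9). -/
theorem weak_harnack {d : ℕ} (hd : 1 ≤ d) (lam Lam C0 : ℝ)
    (hlam : 0 < lam) (hLam : lam ≤ Lam) (hC0 : 0 ≤ C0)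
    (K : Ed d → ℝ) (hK : KernCond K) :
    ∃ ε₃ C : ℝ, 0 < ε₃ ∧ 0 < C ∧
      ∀ r : ℝ, 0 < r → r ≤ 1 →
      ∀ f : Ed d → ℝ, ContinuousOn f (cube d (9 * Real.sqrt d)) →
        IntegrableOn (fun x => |f x| ^ (d : ℝ)) (cube d (9 * Real.sqrt d)) →
      ∀ u : Ed d → ℝ, LowerSemicontinuous u → IsBddFun u → (∀ x, 0 ≤ u x) →
        SupersolExtremal lam Lam C0 r K f (cube d (9 * Real.sqrt d)) u →
        LnormOn ε₃ (cube d 1) u ≤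
          C * (sInf (u '' cube d 1) + LnormOn (d : ℝ) (cube d (9 * Real.sqrt d)) f) := by
  obtain ⟨M, E, θ, hM, hE, hθ0, hθt, hdecay⟩ := decay hd hlam hLam hC0 hK
  have hθr : 0 < θ.toReal := ENNReal.toReal_pos hθ0 hθt
  set s := Real.sqrt (1 + θ.toReal) with hs
  have hs2 : s ^ 2 = 1 + θ.toReal := Real.sq_sqrt (by positivity)
  have hs1 : 1 < s := by
    rw [hs, Real.lt_sqrt (by norm_num)]; linarith
  have hθs : 1 + θ = ENNReal.ofReal (s ^ 2) := by
    rw [hs2, ENNReal.ofReal_add (by norm_num) hθr.le, ENNReal.ofReal_one, ENNReal.ofReal_toReal hθt]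
  have hlogM : 0 < Real.log M := Real.log_pos (by linarith)
  set ε := Real.log s / Real.log M with hεdef
  have hε : 0 < ε := div_pos (Real.log_pos hs1) hlogM
  have hMε : M ^ ε = s := by
    rw [Real.rpow_def_of_pos (by linarith), hεdef, mul_div_cancel₀ _ hlogM.ne',
      Real.exp_log (by linarith)]
  set C1 := volume (dyF (d := d) 0 0) *
    (1 + ∑' k : ℕ, ENNReal.ofReal s ^ (k + 1) * ((1 + θ)⁻¹) ^ k) with hC1
  have hC1t : C1 ≠ ∞ := layer_const hs1 hθs
  set c := C1.toReal ^ (1 / ε) with hc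
  have hc0 : 0 ≤ c := by positivity
  have hdR : (0 : ℝ) < d := by exact_mod_cast hd
  set κ := (2 * E) ^ (1 / (d : ℝ)) with hκ
  have hκ0 : 0 < κ := by positivity
  have hκd : κ ^ d = 2 * E := by
    rw [hκ, ← Real.rpow_natCast, ← Real.rpow_mul (by positivity), one_div_mul_cancel hdR.ne', Real.rpow_one]
  refine ⟨ε, c * (1 + κ) + 1, hε, by positivity, ?_⟩
  intro r hr hr1 f hf hfi u hu hub hu0 hsup
  set S := cube d (9 * Real.sqrt d) with hS
  set I := sInf (u '' cube d 1) with hI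
  set N := LnormOn (d : ℝ) S f with hN
  have hne : (u '' cube d 1).Nonempty := ⟨u 0, 0, fun j => by simp, rfl⟩
  have hI0 : 0 ≤ I := Real.sInf_nonneg (by rintro _ ⟨x, _, rfl⟩; exact hu0 x)
  have hint0 : 0 ≤ ∫ x in S, |f x| ^ (d : ℝ) := integral_nonneg fun x => by positivity
  have hN0 : 0 ≤ N := by rw [hN]; unfold LnormOn; positivity
  have hNd : N ^ d = ∫ x in S, |f x| ^ (d : ℝ) := by
    rw [hN, LnormOn, ← Real.rpow_natCast, ← Real.rpow_mul hint0, one_div_mul_cancel hdR.ne', Real.rpow_one]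
  have hfl : (∫⁻ x in S, ENNReal.ofReal (|f x| ^ d)) = ENNReal.ofReal (N ^ d) := by
    rw [hNd, ofReal_integral_eq_lintegral_ofReal hfi (Filter.Eventually.of_forall fun x => by positivity)]
    simp only [Real.rpow_natCast]
  have key : ∀ η : ℝ, 0 < η → LnormOn ε (cube d 1) u ≤ c * (I + κ * N + η) := by
    intro η hη
    set m := I + κ * N + η with hm
    have hm0 : 0 < m := by positivity
    have hscal := scal_super (x0 := (0 : Ed d)) (ρ := 1) (m := m) (O' := S) hsup hr one_pos hm0
      (fun y hy => by simpa using hy)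
    simp only [one_mul, one_pow, zero_add, one_smul] at hscal
    have hvl : LowerSemicontinuous fun y => u y / m := by
      intro y a ha
      have ha' : a * m < u y := (lt_div_iff₀ hm0).mp ha
      filter_upwards [hu y (a * m) ha'] with z hz
      exact (lt_div_iff₀ hm0).mpr hz
    have hv0 : ∀ y, 0 ≤ u y / m := fun y => div_nonneg (hu0 y) hm0.le
    have hsmall : ENNReal.ofReal E * (∫⁻ x in S, ENNReal.ofReal (|1 / m * f x| ^ d)) ≤ 1 / 2 := by
      have e : ∀ x, ENNReal.ofReal (|1 / m * f x| ^ d) =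
          ENNReal.ofReal ((1 / m) ^ d) * ENNReal.ofReal (|f x| ^ d) := by
        intro x
        rw [← ENNReal.ofReal_mul (by positivity), abs_mul, mul_pow, abs_of_pos (by positivity)]
      simp_rw [e]
      rw [lintegral_const_mul' _ _ ENNReal.ofReal_ne_top, hfl, ← ENNReal.ofReal_mul (by positivity),
        ← ENNReal.ofReal_mul hE.le]
      have e2 : (1 / 2 : ℝ≥0∞) = ENNReal.ofReal (1 / 2) := by
        rw [ENNReal.ofReal_div_of_pos (by norm_num)]; simp
      rw [e2]
      apply ENNReal.ofReal_le_ofReal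
      have h1 : (κ * N) ^ d ≤ m ^ d := by
        gcongr
        rw [hm]; linarith
      rw [mul_pow, hκd] at h1
      rw [one_div, inv_pow, ← mul_assoc, mul_comm E, mul_assoc, inv_mul_le_iff₀ (by positivity)]
      linarith
    have hx1 : ∃ x1 ∈ cube d 1, u x1 / m ≤ 1 := by
      have hlt : I < m := by
        rw [hm]
        have : 0 ≤ κ * N := by positivity
        linarith
      obtain ⟨_, ⟨x1, hx1, rfl⟩, hlt1⟩ := exists_lt_of_csInf_lt hne hlt
      exact ⟨x1, hx1, (div_le_one hm0).mpr hlt1.le⟩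
    have hdec := hdecay r hr hr1 (fun x => 1 / m * f x) (continuousOn_const.mul hf) hsmall
      (fun y => u y / m) hvl hv0 hscal hx1
    have hlay := layer_bound hM hε hMε hvl.measurable hv0 hdec hθt
    have hintv : ∫ x in cube d 1, (u x / m) ^ ε ≤ C1.toReal := by
      rw [integral_eq_lintegral_of_nonneg_ae
        (Filter.Eventually.of_forall fun x => Real.rpow_nonneg (hv0 x) ε)
        (hvl.measurable.pow_const ε).aestronglyMeasurable]
      exact ENNReal.toReal_mono hC1t hlay
    have hintu : ∫ x in cube d 1, |u x| ^ ε ≤ m ^ ε * C1.toReal := by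
      have e : ∀ x, |u x| ^ ε = m ^ ε * (u x / m) ^ ε := by
        intro x
        rw [abs_of_nonneg (hu0 x), ← Real.mul_rpow hm0.le (hv0 x), mul_div_cancel₀ _ hm0.ne']
      simp_rw [e]
      rw [integral_const_mul]
      gcongr
    unfold LnormOn
    calc (∫ x in cube d 1, |u x| ^ ε) ^ (1 / ε) ≤ (m ^ ε * C1.toReal) ^ (1 / ε) := by
          apply Real.rpow_le_rpow _ hintu (by positivity)
          exact integral_nonneg fun x => by positivity
      _ = c * m := by
          rw [Real.mul_rpow (by positivity) (by positivity), ← Real.rpow_mul hm0.le,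
            mul_one_div_cancel hε.ne', Real.rpow_one, mul_comm]
  have hlim : LnormOn ε (cube d 1) u ≤ c * (I + κ * N) := by
    apply le_of_forall_pos_le_add
    intro δ hδ
    have h := key (δ / (c + 1)) (by positivity)
    have h2 : c * (δ / (c + 1)) ≤ δ := by
      rw [← mul_div_assoc, div_le_iff₀ (by positivity)]; nlinarith
    rw [mul_add] at h
    linarith
  refine hlim.trans ?_
  have a1 : 0 ≤ c * κ * I := by positivity
  have a2 : 0 ≤ c * N := by positivity
  nlinarith
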